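/- arXiv:1612.04507 — 6 statements merged into one kernel-verified Lean document; each statement's English description precedes it below -/
import Mathlib

section
/- Let K : ℝ → ℝ be integrable with ∫|K(x)|·|x| dx < ∞. Then ∬_{ℝ²} K(r)K(s)·C₁(r,s) dr ds = ∫_0^∞ ( ∫_t^∞ K(r) dr )² dt + ∫_0^∞ ( ∫_{−∞}^{−t} K(r) dr )² dt. In particular this double integral is always ≥ 0, and it is strictly positive whenever ∫|K(x)| dx > 0; that is, C₁ is an integrally positive definite function. -/
open MeasureTheory Set

/-- The covariance structure of Brownian-motion-driven volatilities:
`C₁(x,y) = min(|x|,|y|)·1_{xy ≥ 0}`. -/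
noncomputable def C1 (x y : ℝ) : ℝ := if 0 ≤ x * y then min |x| |y| else 0

theorem C1_eq_max_add_max (x y : ℝ) : C1 x y = max 0 (min x y) + max 0 (min (-x) (-y)) := by
  unfold C1
  split_ifs with h
  · rcases mul_nonneg_iff.mp h with ⟨hx, hy⟩ | ⟨hx, hy⟩
    · rw [abs_of_nonneg hx, abs_of_nonneg hy, max_eq_right (le_min hx hy),
        max_eq_left (min_le_of_left_le (by linarith)), add_zero]
    · rw [abs_of_nonpos hx, abs_of_nonpos hy, max_eq_left (min_le_of_left_le hx),
        max_eq_right (le_min (by linarith) (by linarith)), zero_add]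
  · rcases mul_neg_iff.mp (not_le.mp h) with ⟨hx, hy⟩ | ⟨hx, hy⟩
    · rw [max_eq_left (min_le_of_right_le hy.le),
        max_eq_left (min_le_of_left_le (by linarith)), add_zero]
    · rw [max_eq_left (min_le_of_left_le hx.le),
        max_eq_left (min_le_of_right_le (by linarith)), add_zero]

/-- The integrand of the layer-cake representation of `∬ f(r)f(s)(r ∧ s)⁺ dr ds`. -/
noncomputable def tailKernel (f : ℝ → ℝ) (q : (ℝ × ℝ) × ℝ) : ℝ :=
  {q : (ℝ × ℝ) × ℝ | q.2 < q.1.1 ∧ q.2 < q.1.2}.indicator (fun q => f q.1.1 * f q.1.2) q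

theorem tailKernel_eq_indicator_Iio (f : ℝ → ℝ) (p : ℝ × ℝ) :
    (fun t => tailKernel f (p, t)) = (Iio (min p.1 p.2)).indicator fun _ => f p.1 * f p.2 := by
  ext t
  simp only [tailKernel, indicator_apply, mem_ofPred_eq, mem_Iio, lt_min_iff]

theorem tailKernel_eq_mul_indicator_Ioi (f : ℝ → ℝ) (p : ℝ × ℝ) (t : ℝ) :
    tailKernel f (p, t) = (Ioi t).indicator f p.1 * (Ioi t).indicator f p.2 := by
  by_cases h₁ : t < p.1 <;> by_cases h₂ : t < p.2 <;> simp [tailKernel, h₁, h₂]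

theorem integral_Ioi_indicator_Iio (m c : ℝ) :
    ∫ t in Ioi (0 : ℝ), (Iio m).indicator (fun _ => c) t = c * max 0 m := by
  rw [setIntegral_indicator measurableSet_Iio, Ioi_inter_Iio, setIntegral_const,
    Real.volume_real_Ioo, sub_zero, smul_eq_mul, mul_comm, max_comm]

theorem integrable_Ioi_indicator_Iio (m c : ℝ) :
    Integrable ((Iio m).indicator fun _ => c) (volume.restrict (Ioi (0 : ℝ))) := by
  rw [integrable_indicator_iff measurableSet_Iio, IntegrableOn,
    Measure.restrict_restrict measurableSet_Iio, inter_comm, Ioi_inter_Iio]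
  exact integrableOn_const measure_Ioo_lt_top.ne

theorem integrable_mul_mul_max_min {f : ℝ → ℝ} (hf : Integrable f)
    (hf1 : Integrable fun x : ℝ => |f x| * |x|) :
    Integrable fun p : ℝ × ℝ => f p.1 * f p.2 * max 0 (min p.1 p.2) := by
  refine (hf.abs.mul_prod hf1).mono' ?_ (.of_forall fun p => ?_)
  · exact (hf.mul_prod hf).aestronglyMeasurable.mul
      (by fun_prop : Continuous fun p : ℝ × ℝ => max 0 (min p.1 p.2)).aestronglyMeasurable
  · rw [Real.norm_eq_abs, abs_mul, abs_mul, mul_assoc,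
      abs_of_nonneg (le_max_left 0 (min p.1 p.2))]
    gcongr
    exact max_le (abs_nonneg _) ((min_le_right _ _).trans (le_abs_self _))

theorem integrable_tailKernel {f : ℝ → ℝ} (hf : Integrable f)
    (hf1 : Integrable fun x : ℝ => |f x| * |x|) :
    Integrable (tailKernel f) ((volume : Measure (ℝ × ℝ)).prod (volume.restrict (Ioi (0 : ℝ)))) := by
  have hmeas : AEStronglyMeasurable (tailKernel f)
      ((volume : Measure (ℝ × ℝ)).prod (volume.restrict (Ioi (0 : ℝ)))) :=
    ((hf.mul_prod hf).aestronglyMeasurable.comp_fst).indicator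
      (MeasurableSet.inter
        (measurableSet_lt measurable_snd (measurable_fst.comp measurable_fst))
        (measurableSet_lt measurable_snd (measurable_snd.comp measurable_fst)))
  rw [integrable_prod_iff hmeas]
  refine ⟨.of_forall fun p => ?_, ?_⟩
  · rw [tailKernel_eq_indicator_Iio]
    exact integrable_Ioi_indicator_Iio _ _
  · refine (integrable_mul_mul_max_min hf hf1).norm.congr (.of_forall fun p => ?_)
    have h (t : ℝ) : ‖tailKernel f (p, t)‖ =
        (Iio (min p.1 p.2)).indicator (fun _ => ‖f p.1 * f p.2‖) t := by
      rw [congrFun (tailKernel_eq_indicator_Iio f p) t, norm_indicator_eq_indicator_norm]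
    simp only [h, integral_Ioi_indicator_Iio]
    rw [norm_mul, Real.norm_of_nonneg (le_max_left 0 (min p.1 p.2))]

theorem integral_tailKernel (f : ℝ → ℝ) (t : ℝ) :
    ∫ p : ℝ × ℝ, tailKernel f (p, t) = (∫ r in Ioi t, f r) ^ 2 := by
  simp only [tailKernel_eq_mul_indicator_Ioi]
  rw [Measure.volume_eq_prod, integral_prod_mul, integral_indicator measurableSet_Ioi, sq]

theorem integrableOn_sq_integral_Ioi {f : ℝ → ℝ} (hf : Integrable f)
    (hf1 : Integrable fun x : ℝ => |f x| * |x|) :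
    IntegrableOn (fun t : ℝ => (∫ r in Ioi t, f r) ^ 2) (Ioi 0) := by
  simpa only [integral_tailKernel, IntegrableOn] using (integrable_tailKernel hf hf1).integral_prod_right

theorem integral_mul_mul_max_min {f : ℝ → ℝ} (hf : Integrable f)
    (hf1 : Integrable fun x : ℝ => |f x| * |x|) :
    ∫ p : ℝ × ℝ, f p.1 * f p.2 * max 0 (min p.1 p.2) =
      ∫ t in Ioi (0 : ℝ), (∫ r in Ioi t, f r) ^ 2 := by
  have h := integral_integral_swap (f := fun p t => tailKernel f (p, t))
    (integrable_tailKernel hf hf1)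
  simpa only [integral_tailKernel, tailKernel_eq_indicator_Iio, integral_Ioi_indicator_Iio] using h

theorem intervalIntegral_eq_zero_of_integral_sq_tail_eq_zero {f : ℝ → ℝ} (hf : Integrable f)
    (hf1 : Integrable fun x : ℝ => |f x| * |x|)
    (h : ∫ t in Ioi (0 : ℝ), (∫ r in Ioi t, f r) ^ 2 = 0) {x : ℝ} (hx : 0 ≤ x) :
    ∫ r in (0)..x, f r = 0 := by
  have htail (t : ℝ) : ∫ r in Ioi t, f r = (∫ r in Ioi 0, f r) - ∫ r in (0)..t, f r := by
    exact eq_sub_of_add_eq' <|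
      intervalIntegral.integral_interval_add_Ioi hf.integrableOn hf.integrableOn
  have hcont : Continuous fun t => ∫ r in Ioi t, f r := by
    rw [funext htail]
    exact continuous_const.sub
      (intervalIntegral.continuous_primitive (fun _ _ => hf.intervalIntegrable) 0)
  rw [integral_eq_zero_iff_of_nonneg (fun t => sq_nonneg _)
    (integrableOn_sq_integral_Ioi hf hf1)] at h
  have hzero : EqOn (fun t => (∫ r in Ioi t, f r) ^ 2) 0 (Ioi 0) :=
    Measure.eqOn_open_of_ae_eq h isOpen_Ioi (hcont.pow 2).continuousOn continuousOn_const
  have hzero' : EqOn (fun t => (∫ r in Ioi t, f r) ^ 2) 0 (Ici 0) := by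
    rw [← closure_Ioi]
    exact hzero.closure (hcont.pow 2) continuous_const
  have h₀ := pow_eq_zero_iff two_ne_zero |>.mp (hzero' (mem_Ici.mpr le_rfl))
  have hx₀ := pow_eq_zero_iff two_ne_zero |>.mp (hzero' (mem_Ici.mpr hx))
  rw [htail x, h₀] at hx₀
  linarith

theorem ae_eq_zero_of_forall_intervalIntegral_eq_zero {f : ℝ → ℝ} (hf : Integrable f)
    (h : ∀ x, ∫ r in (0)..x, f r = 0) : f =ᵐ[volume] 0 := by
  filter_upwards [LocallyIntegrable.ae_hasDerivAt_integral hf.locallyIntegrable] with x hx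
  have hd := hx 0
  simp only [h] at hd
  exact hd.unique (hasDerivAt_const x 0)

/-- `∬ K(r)K(s)C₁(r,s) dr ds = ∫_0^∞ (∫_t^∞ K)² dt + ∫_0^∞ (∫_{−∞}^{−t} K)² dt`; in particular
the double integral is nonnegative, and strictly positive when `∫|K| > 0`, i.e. `C₁` is an
integrally positive definite function (part of Proposition 2.4 of the paper). -/
theorem stmt8 (K : ℝ → ℝ) (hK : Integrable K)
    (hK1 : Integrable (fun x : ℝ => |K x| * |x|)) :
    ((∫ p : ℝ × ℝ, K p.1 * K p.2 * C1 p.1 p.2) =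
      (∫ t in Ioi (0 : ℝ), (∫ r in Ioi t, K r) ^ 2) +
        (∫ t in Ioi (0 : ℝ), (∫ r in Iic (-t), K r) ^ 2)) ∧
    (0 ≤ ∫ p : ℝ × ℝ, K p.1 * K p.2 * C1 p.1 p.2) ∧
    ((0 < ∫ x : ℝ, |K x|) → 0 < ∫ p : ℝ × ℝ, K p.1 * K p.2 * C1 p.1 p.2) := by
  have hN : Integrable fun x => K (-x) := hK.comp_neg
  have hN1 : Integrable fun x => |K (-x)| * |x| := by simpa only [abs_neg] using hK1.comp_neg
  have hneg : ∫ p : ℝ × ℝ, K p.1 * K p.2 * max 0 (min (-p.1) (-p.2)) =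
      ∫ t in Ioi (0 : ℝ), (∫ r in Ioi t, K (-r)) ^ 2 := by
    rw [← integral_mul_mul_max_min hN hN1, ← integral_neg_eq_self]
    simp
  have hint : Integrable fun p : ℝ × ℝ => K p.1 * K p.2 * max 0 (min (-p.1) (-p.2)) := by
    simpa only [Prod.fst_neg, Prod.snd_neg, neg_neg] using
      (integrable_mul_mul_max_min hN hN1).comp_neg
  have hsum : ∫ p : ℝ × ℝ, K p.1 * K p.2 * C1 p.1 p.2 =
      (∫ t in Ioi (0 : ℝ), (∫ r in Ioi t, K r) ^ 2) +
        ∫ t in Ioi (0 : ℝ), (∫ r in Ioi t, K (-r)) ^ 2 := by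
    simp only [C1_eq_max_add_max, mul_add]
    rw [integral_add (integrable_mul_mul_max_min hK hK1) hint,
      integral_mul_mul_max_min hK hK1, hneg]
  have hpos : 0 ≤ ∫ t in Ioi (0 : ℝ), (∫ r in Ioi t, K r) ^ 2 :=
    integral_nonneg fun t => sq_nonneg _
  have hpos' : 0 ≤ ∫ t in Ioi (0 : ℝ), (∫ r in Ioi t, K (-r)) ^ 2 :=
    integral_nonneg fun t => sq_nonneg _
  refine ⟨by simpa only [integral_comp_neg_Ioi] using hsum, hsum ▸ add_nonneg hpos hpos',
    fun hK0 => ?_⟩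
  rw [hsum]
  refine (add_nonneg hpos hpos').lt_of_ne' fun h0 => hK0.ne' ?_
  obtain ⟨h₁, h₂⟩ := (add_eq_zero_iff_of_nonneg hpos hpos').mp h0
  have hae : K =ᵐ[volume] 0 := by
    refine ae_eq_zero_of_forall_intervalIntegral_eq_zero hK fun x => ?_
    rcases le_total 0 x with hx | hx
    · exact intervalIntegral_eq_zero_of_integral_sq_tail_eq_zero hK hK1 h₁ hx
    · have := intervalIntegral_eq_zero_of_integral_sq_tail_eq_zero hN hN1 h₂ (neg_nonneg.mpr hx)
      rw [intervalIntegral.integral_comp_neg, neg_neg, neg_zero] at this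
      rw [intervalIntegral.integral_symm, this, neg_zero]
  exact integral_eq_zero_of_ae (hae.mono fun x hx => by simp [hx])
end

section
/- Let K : ℝ → ℝ be measurable with ∫K(x)² dx < ∞, ∫|K(x)| dx < ∞ and ∫|K(x)|·|x| dx < ∞, and let K_s be its symmetrization. Then: (i) ∫K_s(x)² dx ≤ ∫K(x)² dx; (ii) ∬K_s(x)K_s(y)·C₁(x,y) dx dy ≤ ∬K(x)K(y)·C₁(x,y) dx dy; consequently, for I(K) := (∫K(x)²dx)·(∬K(x)K(y)C₁(x,y)dxdy), one has I(K_s) ≤ I(K). Moreover, equality holds in (i) and in (ii) if and only if K(x) = K(−x) for almost every x ∈ ℝ. -/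
open MeasureTheory Set

theorem C1_neg_neg (x y : ℝ) : C1 (-x) (-y) = C1 x y := by
  simp [C1]

theorem C1_nonneg (x y : ℝ) : 0 ≤ C1 x y := by
  unfold C1
  split_ifs <;> positivity

theorem C1_le_abs_left (x y : ℝ) : C1 x y ≤ |x| := by
  unfold C1
  split_ifs
  · exact min_le_left _ _
  · positivity

theorem measurable_C1 : Measurable fun p : ℝ × ℝ => C1 p.1 p.2 := by
  unfold C1
  refine Measurable.ite (measurableSet_le measurable_const (by fun_prop)) ?_ measurable_const
  exact (measurable_fst.abs).min measurable_snd.abs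

/-- The indicator of the open interval between `0` and `x`. -/
noncomputable def intervalIndicator (x t : ℝ) : ℝ :=
  (Ioo (min 0 x) (max 0 x)).indicator 1 t

theorem measurable_intervalIndicator :
    Measurable fun p : ℝ × ℝ => intervalIndicator p.1 p.2 := by
  have hs : MeasurableSet {p : ℝ × ℝ | min 0 p.1 < p.2 ∧ p.2 < max 0 p.1} :=
    (measurableSet_lt (measurable_const.min measurable_fst) measurable_snd).inter
      (measurableSet_lt measurable_snd (measurable_const.max measurable_fst))
  exact (measurable_const (a := (1 : ℝ))).indicator hs

theorem intervalIndicator_nonneg (x t : ℝ) : 0 ≤ intervalIndicator x t :=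
  indicator_nonneg (fun _ _ => zero_le_one) t

theorem intervalIndicator_mul (x y t : ℝ) :
    intervalIndicator x t * intervalIndicator y t =
      (Ioo (max (min 0 x) (min 0 y)) (min (max 0 x) (max 0 y))).indicator 1 t := by
  simp only [intervalIndicator]
  rw [← Ioo_inter_Ioo, inter_indicator_one, Pi.mul_apply]

theorem integrable_intervalIndicator_mul (x y : ℝ) :
    Integrable fun t => intervalIndicator x t * intervalIndicator y t := by
  simp_rw [intervalIndicator_mul]
  exact (integrable_indicator_iff measurableSet_Ioo).2 (integrableOn_const (by simp))

theorem integral_intervalIndicator_mul (x y : ℝ) :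
    ∫ t, intervalIndicator x t * intervalIndicator y t = C1 x y := by
  simp_rw [intervalIndicator_mul]
  rw [integral_indicator_one measurableSet_Ioo, Real.volume_real_Ioo, C1]
  rcases le_total 0 x with hx | hx <;> rcases le_total 0 y with hy | hy
  · simp [hx, hy, mul_nonneg, abs_of_nonneg]
  · rcases hx.eq_or_lt with rfl | hx'
    · simp [hy]
    rcases hy.eq_or_lt with rfl | hy'
    · simp [hx]
    simp [hx, hy, not_le.2 (mul_neg_of_pos_of_neg hx' hy')]
  · rcases hx.eq_or_lt with rfl | hx'
    · simp [hy]
    rcases hy.eq_or_lt with rfl | hy'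
    · simp [hx]
    simp [hx, hy, not_le.2 (mul_neg_of_neg_of_pos hx' hy')]
  · simp [hx, hy, mul_nonneg_of_nonpos_of_nonpos, abs_of_nonpos, ← min_neg_neg]

theorem integrable_mul_mul_C1 {f : ℝ → ℝ} (hf : Measurable f) (hf1 : Integrable f)
    (hf2 : Integrable fun x => |f x| * |x|) :
    Integrable fun p : ℝ × ℝ => f p.1 * f p.2 * C1 p.1 p.2 := by
  refine (hf2.mul_prod hf1.abs).mono' ?_ (.of_forall fun p => ?_)
  · exact (((hf.comp measurable_fst).mul (hf.comp measurable_snd)).mul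
      measurable_C1).aestronglyMeasurable
  · rw [Real.norm_eq_abs, abs_mul, abs_mul, abs_of_nonneg (C1_nonneg _ _), mul_right_comm]
    gcongr
    exact C1_le_abs_left _ _

theorem integral_mul_mul_C1_nonneg {f : ℝ → ℝ} (hf : Measurable f) (hf1 : Integrable f)
    (hf2 : Integrable fun x => |f x| * |x|) :
    0 ≤ ∫ p : ℝ × ℝ, f p.1 * f p.2 * C1 p.1 p.2 := by
  let G : ℝ × ℝ → ℝ → ℝ := fun p t =>
    (f p.1 * f p.2) * (intervalIndicator p.1 t * intervalIndicator p.2 t)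
  have hG : Integrable (Function.uncurry G) := by
    have hmeas : Measurable (Function.uncurry G) := by
      refine .mul (.mul (by fun_prop) (by fun_prop)) (.mul ?_ ?_)
      · exact measurable_intervalIndicator.comp
          (f := fun q : (ℝ × ℝ) × ℝ => (q.1.1, q.2)) (by fun_prop)
      · exact measurable_intervalIndicator.comp
          (f := fun q : (ℝ × ℝ) × ℝ => (q.1.2, q.2)) (by fun_prop)
    refine (integrable_prod_iff hmeas.aestronglyMeasurable).2 ⟨.of_forall fun p => ?_, ?_⟩
    · exact (integrable_intervalIndicator_mul p.1 p.2).const_mul (f p.1 * f p.2)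
    · refine (integrable_mul_mul_C1 hf hf1 hf2).norm.congr (.of_forall fun p => ?_)
      simp only [Function.uncurry, G, norm_mul, integral_const_mul,
        Real.norm_of_nonneg (intervalIndicator_nonneg _ _), integral_intervalIndicator_mul,
        Real.norm_of_nonneg (C1_nonneg _ _)]
  have hswap : ∫ p : ℝ × ℝ, f p.1 * f p.2 * C1 p.1 p.2 =
      ∫ t, (∫ x, f x * intervalIndicator x t) * ∫ y, f y * intervalIndicator y t := by
    calc
      _ = ∫ p, ∫ t, G p t := by
        simp only [G, integral_const_mul, integral_intervalIndicator_mul]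
      _ = ∫ t, ∫ p, G p t := integral_integral_swap hG
      _ = _ := by
        refine integral_congr_ae (.of_forall fun t => ?_)
        exact (integral_congr_ae (.of_forall fun p => mul_mul_mul_comm _ _ _ _)).trans
          (integral_prod_mul (fun x => f x * intervalIndicator x t)
            (fun x => f x * intervalIndicator x t))
  rw [hswap]
  exact integral_nonneg fun t => mul_self_nonneg _

theorem integral_eq_add_of_add_neg_eq {G : Type*} [MeasurableSpace G] [AddGroup G]
    [MeasurableNeg G] {μ : Measure G} [μ.IsNegInvariant] {g a b : G → ℝ}
    (hg : Integrable g μ) (ha : Integrable a μ) (hb : Integrable b μ)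
    (h : ∀ p, g p + g (-p) = 2 * (a p + b p)) :
    ∫ p, g p ∂μ = ∫ p, a p ∂μ + ∫ p, b p ∂μ := by
  have hsum : ∫ p, (g p + g (-p)) ∂μ = ∫ p, 2 * (a p + b p) ∂μ := by simp only [h]
  rw [integral_add hg hg.comp_neg, integral_neg_eq_self, integral_const_mul,
    integral_add ha hb] at hsum
  linarith

theorem integral_sq_eq_even_add_odd {f : ℝ → ℝ} (hf : MemLp f 2) :
    ∫ x, f x ^ 2 = (∫ x, ((f x + f (-x)) / 2) ^ 2) + ∫ x, ((f x - f (-x)) / 2) ^ 2 := by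
  have hneg : MemLp (fun x => f (-x)) 2 :=
    hf.comp_measurePreserving (Measure.measurePreserving_neg volume)
  refine integral_eq_add_of_add_neg_eq hf.integrable_sq ?_ ?_ fun x => by ring
  · simpa [div_eq_mul_inv] using ((hf.add hneg).mul_const 2⁻¹).integrable_sq
  · simpa [div_eq_mul_inv] using ((hf.sub hneg).mul_const 2⁻¹).integrable_sq

theorem integrable_abs_add_neg_mul_abs {f : ℝ → ℝ} (hf : Measurable f)
    (hf2 : Integrable fun x => |f x| * |x|) :
    Integrable fun x => |(f x + f (-x)) / 2| * |x| := by
  refine (hf2.add hf2.comp_neg).mono' (by fun_prop) (.of_forall fun x => ?_)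
  simp only [Real.norm_eq_abs, abs_mul, abs_abs, abs_neg, Pi.add_apply, ← add_mul, abs_div,
    Nat.abs_ofNat]
  gcongr
  linarith [abs_add_le (f x) (f (-x)), abs_nonneg (f x), abs_nonneg (f (-x))]

theorem integrable_abs_sub_neg_mul_abs {f : ℝ → ℝ} (hf : Measurable f)
    (hf2 : Integrable fun x => |f x| * |x|) :
    Integrable fun x => |(f x - f (-x)) / 2| * |x| := by
  refine (hf2.add hf2.comp_neg).mono' (by fun_prop) (.of_forall fun x => ?_)
  simp only [Real.norm_eq_abs, abs_mul, abs_abs, abs_neg, Pi.add_apply, ← add_mul, abs_div,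
    Nat.abs_ofNat]
  gcongr
  linarith [abs_sub (f x) (f (-x)), abs_nonneg (f x), abs_nonneg (f (-x))]

theorem integral_mul_mul_C1_eq_even_add_odd {f : ℝ → ℝ} (hf : Measurable f)
    (hf1 : Integrable f) (hf2 : Integrable fun x => |f x| * |x|) :
    ∫ p : ℝ × ℝ, f p.1 * f p.2 * C1 p.1 p.2 =
      (∫ p : ℝ × ℝ, (f p.1 + f (-p.1)) / 2 * ((f p.2 + f (-p.2)) / 2) * C1 p.1 p.2) +
        ∫ p : ℝ × ℝ, (f p.1 - f (-p.1)) / 2 * ((f p.2 - f (-p.2)) / 2) * C1 p.1 p.2 := by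
  refine integral_eq_add_of_add_neg_eq (integrable_mul_mul_C1 hf hf1 hf2)
    (integrable_mul_mul_C1 (f := fun x => (f x + f (-x)) / 2) (by fun_prop)
      ((hf1.add hf1.comp_neg).div_const 2) (integrable_abs_add_neg_mul_abs hf hf2))
    (integrable_mul_mul_C1 (f := fun x => (f x - f (-x)) / 2) (by fun_prop)
      ((hf1.sub hf1.comp_neg).div_const 2) (integrable_abs_sub_neg_mul_abs hf hf2)) fun p => ?_
  simp only [Prod.fst_neg, Prod.snd_neg, C1_neg_neg]
  ring

/-- Symmetrization lowers both factors of the objective `I(K)`, hence `I(K_s) ≤ I(K)`, with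
equality in both factors iff `K` is a.e. even (Step 1 of the optimal-kernel derivation,
Section 4.1 of the paper). -/
theorem stmt9 (K : ℝ → ℝ) (hmeas : Measurable K)
    (h2 : Integrable (fun x : ℝ => (K x) ^ 2))
    (h1 : Integrable K)
    (h1' : Integrable (fun x : ℝ => |K x| * |x|)) :
    let Ks : ℝ → ℝ := fun x => (K x + K (-x)) / 2
    ((∫ x : ℝ, (Ks x) ^ 2) ≤ ∫ x : ℝ, (K x) ^ 2) ∧
    ((∫ p : ℝ × ℝ, Ks p.1 * Ks p.2 * C1 p.1 p.2) ≤
      ∫ p : ℝ × ℝ, K p.1 * K p.2 * C1 p.1 p.2) ∧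
    ((∫ x : ℝ, (Ks x) ^ 2) * (∫ p : ℝ × ℝ, Ks p.1 * Ks p.2 * C1 p.1 p.2) ≤
      (∫ x : ℝ, (K x) ^ 2) * (∫ p : ℝ × ℝ, K p.1 * K p.2 * C1 p.1 p.2)) ∧
    (((∫ x : ℝ, (Ks x) ^ 2) = (∫ x : ℝ, (K x) ^ 2) ∧
        (∫ p : ℝ × ℝ, Ks p.1 * Ks p.2 * C1 p.1 p.2) =
          ∫ p : ℝ × ℝ, K p.1 * K p.2 * C1 p.1 p.2) ↔
      (∀ᵐ x : ℝ, K x = K (-x))) := by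
  intro Ks
  have hL2 : MemLp K 2 := (memLp_two_iff_integrable_sq hmeas.aestronglyMeasurable).2 h2
  have hsq := integral_sq_eq_even_add_odd hL2
  have hC := integral_mul_mul_C1_eq_even_add_odd hmeas h1 h1'
  have hodd : 0 ≤ ∫ x, ((K x - K (-x)) / 2) ^ 2 := integral_nonneg fun x => sq_nonneg _
  have hCodd := integral_mul_mul_C1_nonneg (f := fun x => (K x - K (-x)) / 2) (by fun_prop)
    ((h1.sub h1.comp_neg).div_const 2) (integrable_abs_sub_neg_mul_abs hmeas h1')
  have hCeven := integral_mul_mul_C1_nonneg (f := Ks) (by fun_prop)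
    ((h1.add h1.comp_neg).div_const 2) (integrable_abs_add_neg_mul_abs hmeas h1')
  have hi : (∫ x, Ks x ^ 2) ≤ ∫ x, K x ^ 2 := hsq ▸ le_add_of_nonneg_right hodd
  have hii : (∫ p : ℝ × ℝ, Ks p.1 * Ks p.2 * C1 p.1 p.2) ≤
      ∫ p : ℝ × ℝ, K p.1 * K p.2 * C1 p.1 p.2 := hC ▸ le_add_of_nonneg_right hCodd
  refine ⟨hi, hii, mul_le_mul hi hii hCeven (integral_nonneg fun x => sq_nonneg _),
    fun ⟨heq, _⟩ => ?_, fun h => ?_⟩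
  · have hneg : MemLp (fun x => K (-x)) 2 :=
      hL2.comp_measurePreserving (Measure.measurePreserving_neg volume)
    have hint : Integrable fun x => ((K x - K (-x)) / 2) ^ 2 := by
      simpa [div_eq_mul_inv] using ((hL2.sub hneg).mul_const 2⁻¹).integrable_sq
    have hzero : ∫ x, ((K x - K (-x)) / 2) ^ 2 = 0 := by
      rw [hsq] at heq
      exact left_eq_add.1 heq
    filter_upwards [(integral_eq_zero_iff_of_nonneg (fun x => sq_nonneg _) hint).1 hzero]
      with x hx
    have := pow_eq_zero_iff two_ne_zero |>.1 hx
    linarith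
  · have hKs : Ks =ᵐ[volume] K := by
      filter_upwards [h] with x hx
      simp only [Ks, ← hx]
      ring
    refine ⟨integral_congr_ae (hKs.fun_comp (· ^ 2)), integral_congr_ae ?_⟩
    filter_upwards [Measure.quasiMeasurePreserving_fst.ae_eq_comp hKs,
      Measure.quasiMeasurePreserving_snd.ae_eq_comp hKs] with p hp₁ hp₂
    simp only [Function.comp_apply] at hp₁ hp₂
    rw [hp₁, hp₂]
end

section
/- Let γ ∈ (1,2) and C_γ(r,s) := (1/2)(|r|^γ + |s|^γ − |r−s|^γ). Let K : ℝ → ℝ be measurable with ∫|K(x)|·(1 + |x|^γ) dx < ∞ and ∫K(x)² dx < ∞, and let K_s be its symmetrization. Then ∬K_s(x)K_s(y)·C_γ(x,y) dx dy ≤ ∬K(x)K(y)·C_γ(x,y) dx dy; consequently, for I_γ(K) := (∫K(x)²dx)^γ·∬K(x)K(y)C_γ(x,y)dxdy, one has I_γ(K_s) ≤ I_γ(K), so in minimizing I_γ it suffices to consider symmetric kernels. -/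
open MeasureTheory

/-- The fBM increment-covariance structure `C_γ(r,s) = (|r|^γ + |s|^γ − |r−s|^γ)/2`. -/
noncomputable def Cfbm (γ x y : ℝ) : ℝ := (|x| ^ γ + |y| ^ γ - |x - y| ^ γ) / 2

/-- The spectral density weight `(1 - cos t) t^(-1-γ)` is integrable on the half line. -/
lemma integrableOn_one_sub_cos_mul_rpow {γ : ℝ} (hγ0 : 0 < γ) (hγ2 : γ < 2) :
    IntegrableOn (fun t : ℝ => (1 - Real.cos t) * t ^ (-1 - γ)) (Set.Ioi 0) := by
  have hm : Measurable (fun t : ℝ => (1 - Real.cos t) * t ^ (-1 - γ)) := by fun_prop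
  rw [← Set.Ioc_union_Ioi_eq_Ioi zero_le_one]
  refine IntegrableOn.union ?_ ?_
  · have h : IntegrableOn (fun t : ℝ => t ^ (1 - γ)) (Set.Ioc 0 1) :=
      (intervalIntegrable_iff_integrableOn_Ioc_of_le zero_le_one).1
        (intervalIntegral.intervalIntegrable_rpow' (by linarith))
    refine Integrable.mono' h hm.aestronglyMeasurable ?_
    filter_upwards [ae_restrict_mem measurableSet_Ioc] with t ht
    have h0 : 0 ≤ t ^ (-1 - γ) := Real.rpow_nonneg ht.1.le _
    have h1 := Real.one_sub_sq_div_two_le_cos (x := t)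
    have h2 := Real.cos_le_one t
    rw [Real.norm_of_nonneg (mul_nonneg (by linarith) h0)]
    have h3 : t ^ (1 - γ) = t ^ 2 * t ^ (-1 - γ) := by
      rw [← Real.rpow_natCast, ← Real.rpow_add ht.1]
      congr 1
      push_cast
      ring
    rw [h3]
    exact mul_le_mul_of_nonneg_right (by nlinarith [sq_nonneg t]) h0
  · have h : IntegrableOn (fun t : ℝ => 2 * t ^ (-1 - γ)) (Set.Ioi 1) :=
      (integrableOn_Ioi_rpow_of_lt (by linarith) one_pos).const_mul 2
    refine Integrable.mono' h hm.aestronglyMeasurable ?_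
    filter_upwards [ae_restrict_mem measurableSet_Ioi] with t ht
    have h0 : 0 ≤ t ^ (-1 - γ) := Real.rpow_nonneg (zero_le_one.trans ht.out.le) _
    have h1 := Real.neg_one_le_cos t
    have h2 := Real.cos_le_one t
    rw [Real.norm_of_nonneg (mul_nonneg (by linarith) h0)]
    exact mul_le_mul_of_nonneg_right (by linarith) h0

/-- The normalizing constant `∫₀^∞ (1 - cos t) t^(-1-γ) dt`. -/
noncomputable def fbmConst (γ : ℝ) : ℝ :=
  ∫ t in Set.Ioi (0 : ℝ), (1 - Real.cos t) * t ^ (-1 - γ)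

lemma fbmConst_pos {γ : ℝ} (hγ0 : 0 < γ) (hγ2 : γ < 2) : 0 < fbmConst γ := by
  have hnn : ∀ t ∈ Set.Ioi (0 : ℝ), 0 ≤ (1 - Real.cos t) * t ^ (-1 - γ) := fun t ht =>
    mul_nonneg (by linarith [Real.cos_le_one t]) (Real.rpow_nonneg ht.out.le _)
  unfold fbmConst
  rw [setIntegral_pos_iff_support_of_nonneg_ae
    ((ae_restrict_mem measurableSet_Ioi).mono hnn) (integrableOn_one_sub_cos_mul_rpow hγ0 hγ2)]
  refine lt_of_lt_of_le (b := volume (Set.Ioo (0 : ℝ) 1)) (by simp) (measure_mono fun t ht => ?_)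
  refine ⟨?_, ht.1⟩
  have hcos : Real.cos t < 1 := by
    rw [← Real.cos_zero]
    exact Real.cos_lt_cos_of_nonneg_of_le_pi le_rfl
      (by linarith [ht.2, Real.pi_gt_three]) ht.1
  exact (mul_pos (by linarith) (Real.rpow_pos_of_pos ht.1 _)).ne'

lemma one_sub_cos_mul_rpow_comp_mul {γ x t : ℝ} (hx : x ≠ 0) (ht : 0 < t) :
    (1 - Real.cos (t * x)) * t ^ (-1 - γ) =
      |x| ^ (1 + γ) * ((1 - Real.cos (|x| * t)) * (|x| * t) ^ (-1 - γ)) := by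
  have hx' : 0 < |x| := abs_pos.2 hx
  have hcos : Real.cos (|x| * t) = Real.cos (t * x) := by
    rw [← Real.cos_abs (t * x), abs_mul, abs_of_pos ht, mul_comm]
  rw [hcos, Real.mul_rpow hx'.le ht.le]
  have h : |x| ^ (1 + γ) * |x| ^ (-1 - γ) = 1 := by
    rw [← Real.rpow_add hx']
    simp
  linear_combination -((1 - Real.cos (t * x)) * t ^ (-1 - γ)) * h

lemma integrableOn_one_sub_cos_mul {γ : ℝ} (hγ0 : 0 < γ) (hγ2 : γ < 2) (x : ℝ) :
    IntegrableOn (fun t : ℝ => (1 - Real.cos (t * x)) * t ^ (-1 - γ)) (Set.Ioi 0) := by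
  rcases eq_or_ne x 0 with rfl | hx
  · simp
  refine IntegrableOn.congr_fun (Integrable.const_mul ?_ _)
    (fun t ht => (one_sub_cos_mul_rpow_comp_mul hx ht.out).symm) measurableSet_Ioi
  have h := (integrableOn_Ioi_comp_mul_left_iff
    (fun t : ℝ => (1 - Real.cos t) * t ^ (-1 - γ)) 0 (abs_pos.2 hx)).2
  rw [mul_zero] at h
  exact h (integrableOn_one_sub_cos_mul_rpow hγ0 hγ2)

lemma integral_one_sub_cos_mul {γ : ℝ} (hγ0 : 0 < γ) (x : ℝ) :
    ∫ t in Set.Ioi (0 : ℝ), (1 - Real.cos (t * x)) * t ^ (-1 - γ) = |x| ^ γ * fbmConst γ := by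
  rcases eq_or_ne x 0 with rfl | hx
  · simp [Real.zero_rpow hγ0.ne']
  rw [setIntegral_congr_fun measurableSet_Ioi
    (fun t ht => one_sub_cos_mul_rpow_comp_mul hx ht.out), integral_const_mul,
    integral_comp_mul_left_Ioi (fun t : ℝ => (1 - Real.cos t) * t ^ (-1 - γ)) 0 (abs_pos.2 hx),
    mul_zero, smul_eq_mul, ← mul_assoc, Real.rpow_add (abs_pos.2 hx), Real.rpow_one]
  have := (abs_pos.2 hx).ne'
  unfold fbmConst
  field_simp

/-- The spectral integrand of the fBM covariance. -/
noncomputable def fbmSpectral (γ x y t : ℝ) : ℝ :=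
  ((1 - Real.cos (t * x)) * (1 - Real.cos (t * y)) + Real.sin (t * x) * Real.sin (t * y)) *
    t ^ (-1 - γ)

lemma fbmSpectral_eq (γ x y t : ℝ) :
    fbmSpectral γ x y t = (1 - Real.cos (t * x)) * t ^ (-1 - γ) +
      (1 - Real.cos (t * y)) * t ^ (-1 - γ) - (1 - Real.cos (t * (x - y))) * t ^ (-1 - γ) := by
  rw [mul_sub, Real.cos_sub, fbmSpectral]
  ring

lemma integrableOn_fbmSpectral {γ : ℝ} (hγ0 : 0 < γ) (hγ2 : γ < 2) (x y : ℝ) :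
    IntegrableOn (fbmSpectral γ x y) (Set.Ioi 0) := by
  simp only [funext (fbmSpectral_eq γ x y)]
  exact ((integrableOn_one_sub_cos_mul hγ0 hγ2 x).add
    (integrableOn_one_sub_cos_mul hγ0 hγ2 y)).sub (integrableOn_one_sub_cos_mul hγ0 hγ2 (x - y))

lemma integral_fbmSpectral {γ : ℝ} (hγ0 : 0 < γ) (hγ2 : γ < 2) (x y : ℝ) :
    ∫ t in Set.Ioi (0 : ℝ), fbmSpectral γ x y t = 2 * fbmConst γ * Cfbm γ x y := by
  have hi := integrableOn_one_sub_cos_mul hγ0 hγ2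
  simp only [fbmSpectral_eq]
  rw [integral_sub (by exact (hi x).add (hi y)) (hi (x - y)), integral_add (hi x) (hi y)]
  simp only [integral_one_sub_cos_mul hγ0]
  unfold Cfbm
  ring

lemma abs_fbmSpectral_le {γ t : ℝ} (ht : 0 < t) (x y : ℝ) :
    |fbmSpectral γ x y t| ≤ (1 - Real.cos (t * x)) * t ^ (-1 - γ) +
      (1 - Real.cos (t * y)) * t ^ (-1 - γ) := by
  have h0 : 0 ≤ t ^ (-1 - γ) := Real.rpow_nonneg ht.le _
  rw [fbmSpectral, abs_mul, abs_of_nonneg h0, ← add_mul]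
  refine mul_le_mul_of_nonneg_right ?_ h0
  have hx := Real.sin_sq_add_cos_sq (t * x)
  have hy := Real.sin_sq_add_cos_sq (t * y)
  rw [abs_le]
  constructor
  · nlinarith [sq_nonneg ((1 - Real.cos (t * x)) + (1 - Real.cos (t * y))),
      sq_nonneg (Real.sin (t * x) + Real.sin (t * y))]
  · nlinarith [sq_nonneg ((1 - Real.cos (t * x)) - (1 - Real.cos (t * y))),
      sq_nonneg (Real.sin (t * x) - Real.sin (t * y))]

lemma integrable_of_weighted {γ : ℝ} {f : ℝ → ℝ} (hf : Measurable f)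
    (hi : Integrable (fun x : ℝ => |f x| * (1 + |x| ^ γ))) :
    Integrable f ∧ Integrable (fun x : ℝ => |f x| * |x| ^ γ) := by
  refine ⟨hi.mono' hf.aestronglyMeasurable (.of_forall fun x => ?_),
    hi.mono' (by fun_prop) (.of_forall fun x => ?_)⟩
  · rw [Real.norm_eq_abs]
    exact le_mul_of_one_le_right (abs_nonneg _)
      (by linarith [Real.rpow_nonneg (abs_nonneg x) γ])
  · rw [Real.norm_of_nonneg (by positivity)]
    exact mul_le_mul_of_nonneg_left (by linarith) (abs_nonneg _)

lemma integrable_prod_fbmSpectral {γ : ℝ} (hγ0 : 0 < γ) (hγ2 : γ < 2) {f : ℝ → ℝ}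
    (hf : Measurable f) (hi : Integrable (fun x : ℝ => |f x| * (1 + |x| ^ γ))) :
    Integrable (fun q : (ℝ × ℝ) × ℝ => f q.1.1 * f q.1.2 * fbmSpectral γ q.1.1 q.1.2 q.2)
      ((volume : Measure (ℝ × ℝ)).prod (volume.restrict (Set.Ioi 0))) := by
  obtain ⟨h1, hγ⟩ := integrable_of_weighted hf hi
  have hm : Measurable
      (fun q : (ℝ × ℝ) × ℝ => f q.1.1 * f q.1.2 * fbmSpectral γ q.1.1 q.1.2 q.2) := by
    unfold fbmSpectral
    fun_prop
  rw [integrable_prod_iff hm.aestronglyMeasurable]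
  refine ⟨.of_forall fun p =>
    (integrableOn_fbmSpectral hγ0 hγ2 p.1 p.2).const_mul (f p.1 * f p.2), ?_⟩
  have hb : Integrable (fun p : ℝ × ℝ => fbmConst γ *
      (|f p.1| * |p.1| ^ γ * |f p.2| + |f p.1| * (|f p.2| * |p.2| ^ γ))) :=
    ((hγ.mul_prod h1.abs).add (h1.abs.mul_prod hγ)).const_mul _
  refine hb.mono' hm.aestronglyMeasurable.norm.integral_prod_right' (.of_forall fun p => ?_)
  have hc := integrableOn_one_sub_cos_mul hγ0 hγ2
  rw [Real.norm_of_nonneg (integral_nonneg fun _ => norm_nonneg _)]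
  calc ∫ t in Set.Ioi (0 : ℝ), ‖f p.1 * f p.2 * fbmSpectral γ p.1 p.2 t‖
      ≤ ∫ t in Set.Ioi (0 : ℝ), |f p.1 * f p.2| * ((1 - Real.cos (t * p.1)) * t ^ (-1 - γ) +
          (1 - Real.cos (t * p.2)) * t ^ (-1 - γ)) := by
        refine setIntegral_mono_on
          ((integrableOn_fbmSpectral hγ0 hγ2 p.1 p.2).const_mul _).norm
          (((hc p.1).add (hc p.2)).const_mul _) measurableSet_Ioi fun t ht => ?_
        rw [Real.norm_eq_abs, abs_mul]
        exact mul_le_mul_of_nonneg_left (abs_fbmSpectral_le ht.out _ _) (abs_nonneg _)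
    _ = _ := by
        rw [integral_const_mul, integral_add (hc p.1) (hc p.2), integral_one_sub_cos_mul hγ0,
          integral_one_sub_cos_mul hγ0, abs_mul]
        ring

lemma integrable_mul_Cfbm {γ : ℝ} (hγ0 : 0 < γ) (hγ2 : γ < 2) {f : ℝ → ℝ}
    (hf : Measurable f) (hi : Integrable (fun x : ℝ => |f x| * (1 + |x| ^ γ))) :
    Integrable (fun p : ℝ × ℝ => f p.1 * f p.2 * Cfbm γ p.1 p.2) := by
  have h := (integrable_prod_fbmSpectral hγ0 hγ2 hf hi).integral_prod_left.const_mul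
    (2 * fbmConst γ)⁻¹
  refine h.congr (.of_forall fun p => ?_)
  have := (fbmConst_pos hγ0 hγ2).ne'
  simp only [integral_const_mul, integral_fbmSpectral hγ0 hγ2]
  field_simp

/-- The fBM covariance is positive semidefinite. -/
lemma integral_mul_Cfbm_nonneg {γ : ℝ} (hγ0 : 0 < γ) (hγ2 : γ < 2) {f : ℝ → ℝ}
    (hf : Measurable f) (hi : Integrable (fun x : ℝ => |f x| * (1 + |x| ^ γ))) :
    0 ≤ ∫ p : ℝ × ℝ, f p.1 * f p.2 * Cfbm γ p.1 p.2 := by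
  have hM := fbmConst_pos hγ0 hγ2
  have hf1 := (integrable_of_weighted hf hi).1
  have hswap := integral_integral_swap (μ := (volume : Measure (ℝ × ℝ)))
    (ν := volume.restrict (Set.Ioi (0 : ℝ)))
    (f := fun p t => f p.1 * f p.2 * fbmSpectral γ p.1 p.2 t)
    (integrable_prod_fbmSpectral hγ0 hγ2 hf hi)
  have hleft : ∫ p : ℝ × ℝ, ∫ t in Set.Ioi (0 : ℝ), f p.1 * f p.2 * fbmSpectral γ p.1 p.2 t =
      2 * fbmConst γ * ∫ p : ℝ × ℝ, f p.1 * f p.2 * Cfbm γ p.1 p.2 := by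
    rw [← integral_const_mul]
    refine integral_congr_ae (.of_forall fun p => ?_)
    simp only [integral_const_mul, integral_fbmSpectral hγ0 hγ2]
    ring
  rw [hleft] at hswap
  refine nonneg_of_mul_nonneg_right (hswap ▸ ?_) (mul_pos two_pos hM)
  refine setIntegral_nonneg measurableSet_Ioi fun t ht => ?_
  have hcos : Integrable (fun x => f x * (1 - Real.cos (t * x))) := by
    refine hf1.mul_bdd (c := 2) (by fun_prop) (.of_forall fun x => ?_)
    rw [Real.norm_eq_abs, abs_le]
    constructor <;> linarith [Real.cos_le_one (t * x), Real.neg_one_le_cos (t * x)]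
  have hsin : Integrable (fun x => f x * Real.sin (t * x)) := by
    refine hf1.mul_bdd (c := 1) (by fun_prop) (.of_forall fun x => ?_)
    exact Real.abs_sin_le_one _
  have hsplit : ∫ p : ℝ × ℝ, f p.1 * f p.2 * fbmSpectral γ p.1 p.2 t =
      t ^ (-1 - γ) * ((∫ x, f x * (1 - Real.cos (t * x))) ^ 2 +
        (∫ x, f x * Real.sin (t * x)) ^ 2) := by
    rw [sq, sq, ← integral_prod_mul, ← integral_prod_mul,
      ← integral_add (hcos.mul_prod hcos) (hsin.mul_prod hsin), ← integral_const_mul]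
    refine integral_congr_ae (.of_forall fun p => ?_)
    simp only [fbmSpectral]
    ring
  rw [hsplit]
  have := Real.rpow_nonneg ht.out.le (-1 - γ)
  positivity

lemma Cfbm_neg_neg (γ x y : ℝ) : Cfbm γ (-x) (-y) = Cfbm γ x y := by
  have h : -x - -y = -(x - y) := by ring
  simp only [Cfbm, h, abs_neg]

lemma integral_comp_neg_mul_Cfbm (γ : ℝ) (f : ℝ → ℝ) :
    ∫ p : ℝ × ℝ, f (-p.1) * f (-p.2) * Cfbm γ p.1 p.2 =
      ∫ p : ℝ × ℝ, f p.1 * f p.2 * Cfbm γ p.1 p.2 := by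
  rw [← integral_neg_eq_self (fun p : ℝ × ℝ => f p.1 * f p.2 * Cfbm γ p.1 p.2)]
  simp only [Prod.fst_neg, Prod.snd_neg, Cfbm_neg_neg]

lemma integrable_weighted_even {γ : ℝ} {f : ℝ → ℝ} (hf : Measurable f)
    (hi : Integrable (fun x : ℝ => |f x| * (1 + |x| ^ γ))) :
    Integrable (fun x : ℝ => |(f x + f (-x)) / 2| * (1 + |x| ^ γ)) := by
  refine (hi.add hi.comp_neg).mono' (by fun_prop) (.of_forall fun x => ?_)
  have hw : 0 ≤ 1 + |x| ^ γ := by positivity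
  rw [Real.norm_of_nonneg (mul_nonneg (abs_nonneg _) hw)]
  simp only [Pi.add_apply, abs_neg, ← add_mul]
  refine mul_le_mul_of_nonneg_right ?_ hw
  rw [abs_div, abs_two]
  linarith [abs_add_le (f x) (f (-x)), abs_nonneg (f x), abs_nonneg (f (-x))]

lemma integrable_weighted_odd {γ : ℝ} {f : ℝ → ℝ} (hf : Measurable f)
    (hi : Integrable (fun x : ℝ => |f x| * (1 + |x| ^ γ))) :
    Integrable (fun x : ℝ => |(f x - f (-x)) / 2| * (1 + |x| ^ γ)) := by
  refine (hi.add hi.comp_neg).mono' (by fun_prop) (.of_forall fun x => ?_)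
  have hw : 0 ≤ 1 + |x| ^ γ := by positivity
  rw [Real.norm_of_nonneg (mul_nonneg (abs_nonneg _) hw)]
  simp only [Pi.add_apply, abs_neg, ← add_mul]
  refine mul_le_mul_of_nonneg_right ?_ hw
  rw [abs_div, abs_two]
  linarith [abs_sub (f x) (f (-x)), abs_nonneg (f x), abs_nonneg (f (-x))]

/-- The form `∬ f f C_γ` splits over the even and odd parts of `f`. -/
lemma integral_mul_Cfbm_even_add_odd {γ : ℝ} (hγ0 : 0 < γ) (hγ2 : γ < 2) {f : ℝ → ℝ}
    (hf : Measurable f) (hi : Integrable (fun x : ℝ => |f x| * (1 + |x| ^ γ))) :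
    (∫ p : ℝ × ℝ, (f p.1 + f (-p.1)) / 2 * ((f p.2 + f (-p.2)) / 2) * Cfbm γ p.1 p.2) +
      (∫ p : ℝ × ℝ, (f p.1 - f (-p.1)) / 2 * ((f p.2 - f (-p.2)) / 2) * Cfbm γ p.1 p.2) =
      ∫ p : ℝ × ℝ, f p.1 * f p.2 * Cfbm γ p.1 p.2 := by
  have hi' : Integrable (fun x : ℝ => |f (-x)| * (1 + |x| ^ γ)) := by
    simpa only [abs_neg] using hi.comp_neg
  rw [← integral_add
    (integrable_mul_Cfbm hγ0 hγ2 (f := fun x => (f x + f (-x)) / 2) (by fun_prop)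
      (integrable_weighted_even hf hi))
    (integrable_mul_Cfbm hγ0 hγ2 (f := fun x => (f x - f (-x)) / 2) (by fun_prop)
      (integrable_weighted_odd hf hi))]
  calc _ = ∫ p : ℝ × ℝ, (1 / 2) * (f p.1 * f p.2 * Cfbm γ p.1 p.2 +
        f (-p.1) * f (-p.2) * Cfbm γ p.1 p.2) := by
        congr 1
        ext p
        ring
    _ = _ := by
        rw [integral_const_mul, integral_add (integrable_mul_Cfbm hγ0 hγ2 hf hi)
          (integrable_mul_Cfbm hγ0 hγ2 (f := fun x => f (-x)) (by fun_prop) hi'),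
          integral_comp_neg_mul_Cfbm]
        ring

lemma integral_sq_even_le {f : ℝ → ℝ} (h2 : Integrable (fun x : ℝ => f x ^ 2)) :
    ∫ x : ℝ, ((f x + f (-x)) / 2) ^ 2 ≤ ∫ x : ℝ, f x ^ 2 := by
  calc ∫ x : ℝ, ((f x + f (-x)) / 2) ^ 2
      ≤ ∫ x : ℝ, (1 / 2) * (f x ^ 2 + f (-x) ^ 2) := by
        refine integral_mono_of_nonneg (.of_forall fun x => sq_nonneg _)
          ((h2.add h2.comp_neg).const_mul _) (.of_forall fun x => ?_)
        change ((f x + f (-x)) / 2) ^ 2 ≤ (1 / 2) * (f x ^ 2 + f (-x) ^ 2)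
        nlinarith [sq_nonneg (f x - f (-x))]
    _ = _ := by
        rw [integral_const_mul, integral_add h2 h2.comp_neg,
          integral_neg_eq_self (fun x => f x ^ 2)]
        ring

/-- For `γ ∈ (1,2)`, symmetrization does not increase the quadratic form
`∬ K K C_γ`, hence does not increase `I_γ(K) = (∫K²)^γ · ∬ K K C_γ`; so in minimizing `I_γ`
it suffices to consider symmetric kernels (Section 4.3 of the paper). -/
theorem stmt13 (γ : ℝ) (hγ1 : 1 < γ) (hγ2 : γ < 2) (K : ℝ → ℝ) (hmeas : Measurable K)
    (hint : Integrable (fun x : ℝ => |K x| * (1 + |x| ^ γ)))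
    (h2 : Integrable (fun x : ℝ => (K x) ^ 2)) :
    let Ks : ℝ → ℝ := fun x => (K x + K (-x)) / 2
    ((∫ p : ℝ × ℝ, Ks p.1 * Ks p.2 * Cfbm γ p.1 p.2) ≤
      ∫ p : ℝ × ℝ, K p.1 * K p.2 * Cfbm γ p.1 p.2) ∧
    ((∫ x : ℝ, (Ks x) ^ 2) ^ γ * (∫ p : ℝ × ℝ, Ks p.1 * Ks p.2 * Cfbm γ p.1 p.2) ≤
      (∫ x : ℝ, (K x) ^ 2) ^ γ * (∫ p : ℝ × ℝ, K p.1 * K p.2 * Cfbm γ p.1 p.2)) := by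
  intro Ks
  have hγ0 : 0 < γ := zero_lt_one.trans hγ1
  have hodd := integral_mul_Cfbm_nonneg hγ0 hγ2 (f := fun x => (K x - K (-x)) / 2)
    (by fun_prop) (integrable_weighted_odd hmeas hint)
  have hle : (∫ p : ℝ × ℝ, Ks p.1 * Ks p.2 * Cfbm γ p.1 p.2) ≤
      ∫ p : ℝ × ℝ, K p.1 * K p.2 * Cfbm γ p.1 p.2 := by
    rw [← integral_mul_Cfbm_even_add_odd hγ0 hγ2 hmeas hint]
    exact le_add_of_nonneg_right hodd
  have hsq : 0 ≤ ∫ x : ℝ, (Ks x) ^ 2 := integral_nonneg fun x => sq_nonneg _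
  refine ⟨hle, (mul_le_mul_of_nonneg_left hle (Real.rpow_nonneg hsq γ)).trans ?_⟩
  exact mul_le_mul_of_nonneg_right (Real.rpow_le_rpow hsq (integral_sq_even_le h2) hγ0.le)
    (integral_mul_Cfbm_nonneg hγ0 hγ2 hmeas hint)
end

section
/- Let p ≥ 1 be an integer and define K_p : [0,1] → ℝ by K_p(x) := ((p+1)/(2p))·(1 − x^p). Then ∫_0^1 K_p(x) dx = 1/2, and K_p is a critical point of the order-p kernel objective I_p(K) := ( ∫_0^1 K(x)² dx )^p · ∫_0^1 K(x)·x^p dx: for every continuous η : [0,1] → ℝ with ∫_0^1 η(x) dx = 0, the function ε ↦ ( ∫_0^1 (K_p(x) + ε·η(x))² dx )^p · ∫_0^1 (K_p(x) + ε·η(x))·x^p dx has derivative 0 at ε = 0. (For p = 2, K_2(x) = (3/4)(1 − x²) is the Epanechnikov kernel.) -/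
open MeasureTheory Set intervalIntegral

/-- The integral of the square of a perturbation `c (1 - x ^ p) + ε η` with `∫ η = 0`, as a
quadratic polynomial in `ε`. -/
lemma integral_perturbation_sq (p : ℕ) (c ε : ℝ) {η : ℝ → ℝ} (hη : ContinuousOn η (Icc 0 1))
    (h0 : (∫ x in (0 : ℝ)..1, η x) = 0) :
    (∫ x in (0 : ℝ)..1, (c * (1 - x ^ p) + ε * η x) ^ 2) =
      c ^ 2 * (1 - 2 / (p + 1) + 1 / (2 * p + 1)) - 2 * ε * c * (∫ x in (0 : ℝ)..1, η x * x ^ p) +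
        ε ^ 2 * ∫ x in (0 : ℝ)..1, η x ^ 2 := by
  rw [← uIcc_of_le zero_le_one] at hη
  have hpow (n : ℕ) : IntervalIntegrable (fun x : ℝ => x ^ n) volume 0 1 :=
    (continuous_pow n).intervalIntegrable 0 1
  have i1 : IntervalIntegrable η volume 0 1 := hη.intervalIntegrable
  have i2 : IntervalIntegrable (fun x => η x * x ^ p) volume 0 1 :=
    (hη.mul (continuous_pow p).continuousOn).intervalIntegrable
  have i3 : IntervalIntegrable (fun x => η x ^ 2) volume 0 1 := (hη.pow 2).intervalIntegrable
  have i4 : IntervalIntegrable (fun _ : ℝ => c ^ 2) volume 0 1 := intervalIntegrable_const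
  have e : (fun x : ℝ => (c * (1 - x ^ p) + ε * η x) ^ 2) = fun x =>
      c ^ 2 - 2 * c ^ 2 * x ^ p + c ^ 2 * x ^ (2 * p) + 2 * ε * c * η x
        - 2 * ε * c * (η x * x ^ p) + ε ^ 2 * η x ^ 2 := by
    funext x
    ring
  have j1 := i4.sub ((hpow p).const_mul (2 * c ^ 2))
  have j2 := j1.add ((hpow (2 * p)).const_mul (c ^ 2))
  have j3 := j2.add (i1.const_mul (2 * ε * c))
  have j4 := j3.sub (i2.const_mul (2 * ε * c))
  rw [e, integral_add j4 (i3.const_mul _), integral_sub j3 (i2.const_mul _),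
    integral_add j2 (i1.const_mul _), integral_add j1 ((hpow (2 * p)).const_mul _),
    integral_sub i4 ((hpow p).const_mul _)]
  simp only [intervalIntegral.integral_const_mul, h0, integral_pow, intervalIntegral.integral_const]
  simp
  ring

/-- The `p`-th moment of a perturbation `c (1 - x ^ p) + ε η`, as an affine function of `ε`. -/
lemma integral_perturbation_mul_pow (p : ℕ) (c ε : ℝ) {η : ℝ → ℝ}
    (hη : ContinuousOn η (Icc 0 1)) :
    (∫ x in (0 : ℝ)..1, (c * (1 - x ^ p) + ε * η x) * x ^ p) =
      c * (1 / (p + 1) - 1 / (2 * p + 1)) + ε * ∫ x in (0 : ℝ)..1, η x * x ^ p := by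
  rw [← uIcc_of_le zero_le_one] at hη
  have hpow (n : ℕ) : IntervalIntegrable (fun x : ℝ => x ^ n) volume 0 1 :=
    (continuous_pow n).intervalIntegrable 0 1
  have i2 : IntervalIntegrable (fun x => η x * x ^ p) volume 0 1 :=
    (hη.mul (continuous_pow p).continuousOn).intervalIntegrable
  have e : (fun x : ℝ => (c * (1 - x ^ p) + ε * η x) * x ^ p) = fun x =>
      c * x ^ p - c * x ^ (2 * p) + ε * (η x * x ^ p) := by
    funext x
    ring
  rw [e, integral_add (((hpow p).const_mul _).sub ((hpow (2 * p)).const_mul _)) (i2.const_mul _),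
    integral_sub ((hpow p).const_mul _) ((hpow (2 * p)).const_mul _)]
  simp only [intervalIntegral.integral_const_mul, integral_pow]
  simp
  ring

/-- `K_p(x) = ((p+1)/(2p))(1 − x^p)` integrates to `1/2` on `[0,1]` and is a critical point of
the order-`p` kernel objective `I_p(K) = (∫_0^1 K²)^p · ∫_0^1 K(x)x^p dx` among perturbations
with mean-zero directions (Section 4.4 of the paper; for `p = 2` this is the Epanechnikov
kernel). -/
theorem stmt15 (p : ℕ) (hp : 1 ≤ p) :
    let Kp : ℝ → ℝ := fun x => ((p + 1 : ℝ) / (2 * p)) * (1 - x ^ p)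
    (∫ x in (0 : ℝ)..1, Kp x) = 1 / 2 ∧
    ∀ η : ℝ → ℝ, ContinuousOn η (Icc 0 1) → (∫ x in (0 : ℝ)..1, η x) = 0 →
      HasDerivAt
        (fun ε : ℝ =>
          (∫ x in (0 : ℝ)..1, (Kp x + ε * η x) ^ 2) ^ p *
            ∫ x in (0 : ℝ)..1, (Kp x + ε * η x) * x ^ p)
        0 0 := by
  intro Kp
  have hp0 : (p : ℝ) ≠ 0 := by exact_mod_cast (by omega : p ≠ 0)
  have hp1 : (p : ℝ) + 1 ≠ 0 := by positivity
  have hp2 : 2 * (p : ℝ) + 1 ≠ 0 := by positivity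
  refine ⟨?_, fun η hη h0 => ?_⟩
  · simp only [Kp]
    rw [intervalIntegral.integral_const_mul, integral_sub intervalIntegrable_const
      ((continuous_pow p).intervalIntegrable 0 1), integral_pow]
    simp
    field_simp
    ring
  · simp only [Kp, integral_perturbation_sq p _ _ hη h0, integral_perturbation_mul_pow p _ _ hη]
    generalize (∫ x in (0 : ℝ)..1, η x * x ^ p) = m
    generalize (∫ x in (0 : ℝ)..1, η x ^ 2) = D
    set c : ℝ := ((p : ℝ) + 1) / (2 * p)
    set A : ℝ := c ^ 2 * (1 - 2 / (p + 1) + 1 / (2 * p + 1)) with hA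
    set B : ℝ := c * (1 / (p + 1) - 1 / (2 * p + 1)) with hB
    have hAB : A = 2 * p * c * B := by
      rw [hA, hB]
      field_simp
      ring
    have h2 : HasDerivAt (fun ε : ℝ => A - 2 * ε * c * m + ε ^ 2 * D) (-(2 * c * m)) 0 := by
      have h := (((((hasDerivAt_id (0 : ℝ)).const_mul 2).mul_const c).mul_const m).const_sub A).add
        (((hasDerivAt_id (0 : ℝ)).pow 2).mul_const D)
      exact h.congr_deriv (by simp)
    have h1 : HasDerivAt (fun ε : ℝ => B + ε * m) m 0 := by
      simpa using ((hasDerivAt_id (0 : ℝ)).mul_const m).const_add B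
    refine ((h2.pow p).mul h1).congr_deriv ?_
    obtain ⟨q, rfl⟩ : ∃ q, p = q + 1 := ⟨p - 1, by omega⟩
    have hpow : A ^ (q + 1) = A ^ q * (2 * ((q + 1 : ℕ) : ℝ) * c * B) := by rw [pow_succ, ← hAB]
    simp only [Pi.pow_apply, mul_zero, zero_mul, sub_zero, add_zero, Nat.add_sub_cancel, ne_eq,
      OfNat.ofNat_ne_zero, not_false_eq_true, zero_pow]
    rw [hpow]
    ring
end

section
/- Let A, B, γ > 0 and set f(x,y) := A·x + B·y^γ for x, y > 0. Let F : (0,∞) × (0,∞) → [0,∞) satisfy: (i) F(x,y) − f(x,y) = o(x) + o(y^γ) as (x,y) → (0⁺,0⁺) (i.e., for every ε > 0 there is δ > 0 such that |F(x,y) − f(x,y)| ≤ ε·(x + y^γ) whenever 0 < x,y < δ); and (ii) for every δ > 0 there exists m > 0 such that F(x,y) > m for all (x,y) with x > δ or y > δ. Let z_n be a sequence of positive reals decreasing to 0, and let y_n := (A·z_n/(B·γ))^{1/(γ+1)} be the minimizer of y ↦ f(z_n/y, y) over y > 0. Then, as n → ∞: (a) inf_{y>0} F(z_n/y, y) → 0;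 (b) F(z_n/y_n, y_n) − inf_{y>0} F(z_n/y, y) = o( inf_{y>0} F(z_n/y, y) ); and (c) for every sequence (y*_n) of positive reals with F(z_n/y*_n, y*_n) − inf_{y>0} F(z_n/y, y) = o( inf_{y>0} F(z_n/y, y) ), one has y_n / y*_n → 1. -/
open Filter Topology Asymptotics Set

/-- The excess of `s ↦ γ s + s ^ (-γ)` over its minimum value `γ + 1`, attained at `s = 1`. -/
lemma add_one_add_sq_sqrt_sub_one_le {γ s : ℝ} (hγ : 0 < γ) (hs : 0 < s) :
    γ + 1 + γ * (√s - 1) ^ 2 ≤ γ * s + s ^ (-γ) := by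
  have hpow : 1 - γ * Real.log s ≤ s ^ (-γ) := by
    rw [Real.rpow_def_of_pos hs]
    linarith [Real.add_one_le_exp (Real.log s * -γ)]
  have hsqrt : 0 < √s := Real.sqrt_pos.2 hs
  have hsq : √s ^ 2 = s := Real.sq_sqrt hs.le
  have hlog : Real.log s ≤ 2 * (√s - 1) := by
    rw [← hsq, Real.log_pow, hsq]
    push_cast
    linarith [Real.log_le_sub_one_of_pos hsqrt]
  nlinarith [mul_le_mul_of_nonneg_left hlog hγ.le]

/-- Quadratic lower bound for `A x + B w ^ γ` along `x = z / w`, around its minimizer `y`, which is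
characterized by `A z = B γ y ^ (γ + 1)`. -/
lemma min_add_sq_le_along_hyperbola {A B γ z y w : ℝ} (hB : 0 < B) (hγ : 0 < γ)
    (hy : 0 < y) (hw : 0 < w) (hzy : A * z = B * γ * (y ^ γ * y)) :
    B * (γ + 1) * y ^ γ + B * γ * y ^ γ * (√(y / w) - 1) ^ 2 ≤ A * (z / w) + B * w ^ γ := by
  have hP : 0 < y ^ γ := Real.rpow_pos_of_pos hy γ
  have hs : (y / w) ^ (-γ) = w ^ γ / y ^ γ := by
    rw [Real.rpow_neg (div_pos hy hw).le, Real.div_rpow hy.le hw.le, inv_div]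
  have h := add_one_add_sq_sqrt_sub_one_le hγ (div_pos hy hw)
  rw [hs] at h
  calc _ = B * y ^ γ * (γ + 1 + γ * (√(y / w) - 1) ^ 2) := by ring
    _ ≤ B * y ^ γ * (γ * (y / w) + w ^ γ / y ^ γ) := by gcongr
    _ = B * γ * (y ^ γ * y) / w + B * w ^ γ := by field_simp
    _ = _ := by rw [← hzy]; ring

/-- An additive error `o(x) + o(y ^ γ)` is a relative error with respect to `A x + B y ^ γ`. -/
lemma exists_relative_error_bound {A B γ : ℝ} (hA : 0 < A) (hB : 0 < B) {F : ℝ → ℝ → ℝ}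
    (happrox : ∀ ε : ℝ, 0 < ε → ∃ δ : ℝ, 0 < δ ∧ ∀ x y : ℝ,
      0 < x → x < δ → 0 < y → y < δ →
        |F x y - (A * x + B * y ^ γ)| ≤ ε * (x + y ^ γ))
    {ε : ℝ} (hε : 0 < ε) :
    ∃ δ : ℝ, 0 < δ ∧ ∀ x y : ℝ, 0 < x → x < δ → 0 < y → y < δ →
      |F x y - (A * x + B * y ^ γ)| ≤ ε * (A * x + B * y ^ γ) := by
  obtain ⟨δ, hδ, h⟩ := happrox (ε * min A B) (mul_pos hε (lt_min hA hB))
  refine ⟨δ, hδ, fun x y hx hxδ hy hyδ => (h x y hx hxδ hy hyδ).trans ?_⟩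
  have hP : 0 < y ^ γ := Real.rpow_pos_of_pos hy γ
  rw [mul_assoc, mul_add]
  gcongr
  · exact min_le_left A B
  · exact min_le_right A B

/-- Two-sided relative bounds give asymptotic equivalence. -/
lemma isEquivalent_of_eventually_relative_bounds {u v : ℕ → ℝ} (hv : ∀ n, 0 < v n)
    (h : ∀ ε : ℝ, 0 < ε → ∀ᶠ n in atTop, (1 - ε) * v n ≤ u n ∧ u n ≤ (1 + ε) * v n) :
    u ~[atTop] v := by
  refine isLittleO_iff.2 fun ε hε => ?_
  filter_upwards [h ε hε] with n hn
  rw [Pi.sub_apply, Real.norm_eq_abs, Real.norm_of_nonneg (hv n).le, abs_le]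
  constructor <;> linarith [hn.1, hn.2]

/-- The deterministic bandwidth-approximation lemma (Lemma A.1 / "Approximation Bandwidth
Lemma" of the paper): the minimizer `y_n` of the first-order approximation
`f(x,y) = A·x + B·y^γ` of `F` along `x = z_n/y` is asymptotically equivalent to any sequence of
near-minimizers of `F`, and achieves the infimum of `F` up to lower-order terms. -/
theorem stmt16 (A B γ : ℝ) (hA : 0 < A) (hB : 0 < B) (hγ : 0 < γ)
    (F : ℝ → ℝ → ℝ)
    (hFnn : ∀ x y : ℝ, 0 < x → 0 < y → 0 ≤ F x y)
    (happrox : ∀ ε : ℝ, 0 < ε → ∃ δ : ℝ, 0 < δ ∧ ∀ x y : ℝ,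
      0 < x → x < δ → 0 < y → y < δ →
        |F x y - (A * x + B * y ^ γ)| ≤ ε * (x + y ^ γ))
    (hbig : ∀ δ : ℝ, 0 < δ → ∃ m : ℝ, 0 < m ∧ ∀ x y : ℝ,
      0 < x → 0 < y → (δ < x ∨ δ < y) → m < F x y)
    (z : ℕ → ℝ) (hz : ∀ n, 0 < z n) (hzdec : StrictAnti z)
    (hz0 : Tendsto z atTop (𝓝 0))
    (y : ℕ → ℝ) (hy : ∀ n, y n = (A * z n / (B * γ)) ^ (1 / (γ + 1))) :
    let Φ : ℕ → ℝ := fun n => ⨅ w : Ioi (0 : ℝ), F (z n / (w : ℝ)) (w : ℝ)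
    Tendsto Φ atTop (𝓝 0) ∧
    (fun n => F (z n / y n) (y n) - Φ n) =o[atTop] Φ ∧
    (∀ ystar : ℕ → ℝ, (∀ n, 0 < ystar n) →
      (fun n => F (z n / ystar n) (ystar n) - Φ n) =o[atTop] Φ →
      Tendsto (fun n => y n / ystar n) atTop (𝓝 1)) := by
  intro Φ
  have hypos : ∀ n, 0 < y n := fun n => by
    rw [hy]
    exact Real.rpow_pos_of_pos (div_pos (mul_pos hA (hz n)) (mul_pos hB hγ)) _
  have hzy : ∀ n, A * z n = B * γ * (y n ^ γ * y n) := fun n => by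
    have h0 : 0 ≤ A * z n / (B * γ) := (div_pos (mul_pos hA (hz n)) (mul_pos hB hγ)).le
    have h1 : y n ^ γ * y n = A * z n / (B * γ) := by
      rw [← Real.rpow_add_one (hypos n).ne', hy, ← Real.rpow_mul h0,
        one_div_mul_cancel (by positivity), Real.rpow_one]
    rw [h1]
    field_simp
  have hy0 : Tendsto y atTop (𝓝 0) := by
    have h1 : Tendsto (fun n => A * z n / (B * γ)) atTop (𝓝 0) := by
      simpa using (hz0.const_mul A).div_const (B * γ)
    have h2 := h1.rpow_const (p := 1 / (γ + 1)) (Or.inr (by positivity))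
    rw [Real.zero_rpow (by positivity)] at h2
    exact h2.congr fun n => (hy n).symm
  have hP0 : Tendsto (fun n => y n ^ γ) atTop (𝓝 0) := by
    simpa [Real.zero_rpow hγ.ne'] using hy0.rpow_const (p := γ) (Or.inr hγ.le)
  have hPpos : ∀ n, 0 < y n ^ γ := fun n => Real.rpow_pos_of_pos (hypos n) γ
  have hxeq : ∀ n, z n / y n = B * γ / A * y n ^ γ := fun n => by
    have := hypos n
    field_simp
    linarith [hzy n]
  have hx0 : Tendsto (fun n => z n / y n) atTop (𝓝 0) := by
    simp_rw [hxeq]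
    simpa using hP0.const_mul (B * γ / A)
  set M : ℕ → ℝ := fun n => B * (γ + 1) * y n ^ γ with hM
  have hMpos : ∀ n, 0 < M n := fun n => by
    have := hPpos n
    positivity
  have hM0 : Tendsto M atTop (𝓝 0) := by simpa using hP0.const_mul (B * (γ + 1))
  have hfy : ∀ n, A * (z n / y n) + B * y n ^ γ = M n := fun n => by
    rw [hxeq, hM]
    field_simp
  have hlow : ∀ n w, 0 < w →
      M n + B * γ * y n ^ γ * (√(y n / w) - 1) ^ 2 ≤ A * (z n / w) + B * w ^ γ :=
    fun n w hw => min_add_sq_le_along_hyperbola hB hγ (hypos n) hw (hzy n)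
  have hsublevel : ∀ ε : ℝ, 0 < ε → ∃ m : ℝ, 0 < m ∧ ∀ n w, 0 < w → F (z n / w) w ≤ m →
      (1 - ε) * (A * (z n / w) + B * w ^ γ) ≤ F (z n / w) w := fun ε hε => by
    obtain ⟨δ, hδ, h⟩ := exists_relative_error_bound hA hB happrox hε
    obtain ⟨m, hm, h'⟩ := hbig (δ / 2) (half_pos hδ)
    refine ⟨m, hm, fun n w hw hle => ?_⟩
    have hx : 0 < z n / w := div_pos (hz n) hw
    have hnot : ¬(δ / 2 < z n / w ∨ δ / 2 < w) := fun hor => (h' _ _ hx hw hor).not_ge hle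
    rw [not_or, not_lt, not_lt] at hnot
    have := (abs_le.1 (h _ _ hx (by linarith [hnot.1]) hw (by linarith [hnot.2]))).1
    linarith
  have hbdd : ∀ n, BddBelow (range fun w : Ioi (0 : ℝ) => F (z n / (w : ℝ)) (w : ℝ)) := fun n =>
    ⟨0, by
      rintro _ ⟨w, rfl⟩
      exact hFnn _ _ (div_pos (hz n) w.2) w.2⟩
  have hΦle : ∀ n, Φ n ≤ F (z n / y n) (y n) := fun n => ciInf_le (hbdd n) ⟨y n, hypos n⟩
  have hupper : ∀ ε : ℝ, 0 < ε → ∀ᶠ n in atTop, F (z n / y n) (y n) ≤ (1 + ε) * M n :=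
    fun ε hε => by
      obtain ⟨δ, hδ, h⟩ := exists_relative_error_bound hA hB happrox hε
      filter_upwards [hy0.eventually_lt_const hδ, hx0.eventually_lt_const hδ] with n hyn hxn
      have := (abs_le.1 (h _ _ (div_pos (hz n) (hypos n)) hxn (hypos n) hyn)).2
      rw [hfy] at this
      linarith
  have hlower : ∀ ε : ℝ, 0 < ε → ∀ᶠ n in atTop, (1 - ε) * M n ≤ Φ n := fun ε hε => by
    obtain ⟨m, hm, h⟩ := hsublevel (min ε 1) (lt_min hε one_pos)
    filter_upwards [hM0.eventually_lt_const hm] with n hn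
    refine le_ciInf fun ⟨w, hw⟩ => ?_
    have hw' : 0 < w := hw
    have hMn := hMpos n
    have hε1 : (1 - ε) * M n ≤ (1 - min ε 1) * M n := by
      gcongr
      exact min_le_left _ _
    refine hε1.trans ?_
    rcases le_total (F (z n / w) w) m with hle | hge
    · refine le_trans ?_ (h n w hw' hle)
      have hfw : M n ≤ A * (z n / w) + B * w ^ γ := by
        have := hPpos n
        exact (le_add_of_nonneg_right (by positivity)).trans (hlow n w hw')
      exact mul_le_mul_of_nonneg_left hfw (sub_nonneg.2 (min_le_right _ _))
    · have : 0 < min ε 1 := lt_min hε one_pos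
      change _ ≤ F (z n / w) w
      nlinarith
  have hΦM : Φ ~[atTop] M := isEquivalent_of_eventually_relative_bounds hMpos fun ε hε => by
    filter_upwards [hlower ε hε, hupper ε hε] with n h1 h2
    exact ⟨h1, (hΦle n).trans h2⟩
  have hFM : (fun n => F (z n / y n) (y n)) ~[atTop] M :=
    isEquivalent_of_eventually_relative_bounds hMpos fun ε hε => by
      filter_upwards [hlower ε hε, hupper ε hε] with n h1 h2
      exact ⟨h1.trans (hΦle n), h2⟩
  refine ⟨hΦM.symm.tendsto_nhds hM0, (hFM.trans hΦM.symm).isLittleO, fun v hv hvΦ => ?_⟩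
  have hvM : (fun n => F (z n / v n) (v n)) ~[atTop] M := IsEquivalent.trans hvΦ hΦM
  have hv0 := hvM.symm.tendsto_nhds hM0
  have hsq : Tendsto (fun n => (√(y n / v n) - 1) ^ 2) atTop (𝓝 0) := by
    refine tendsto_order.2 ⟨fun a ha => .of_forall fun n => ha.trans_le (sq_nonneg _),
      fun c hc => ?_⟩
    obtain ⟨ε, hε, hε2, hεc⟩ : ∃ ε : ℝ, 0 < ε ∧ ε ≤ 1 / 2 ∧ 4 * ε * (γ + 1) < γ * c := by
      refine ⟨min (1 / 2) (γ * c / (8 * (γ + 1))), by positivity, min_le_left _ _, ?_⟩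
      have h1 : min (1 / 2) (γ * c / (8 * (γ + 1))) * (8 * (γ + 1)) ≤ γ * c :=
        (le_div_iff₀ (by positivity)).1 (min_le_right _ _)
      nlinarith [mul_pos hγ hc]
    obtain ⟨m, hm, h⟩ := hsublevel ε hε
    filter_upwards [hv0.eventually_lt_const hm, isLittleO_iff.1 hvM hε] with n hvm hvn
    rw [Pi.sub_apply, Real.norm_eq_abs, Real.norm_of_nonneg (hMpos n).le] at hvn
    have h1 := h n (v n) (hv n) hvm.le
    have h2 := mul_le_mul_of_nonneg_left (hlow n (v n) (hv n)) (by linarith : 0 ≤ 1 - ε)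
    have h3 := (abs_le.1 hvn).2
    set d := (√(y n / v n) - 1) ^ 2
    have hd : 0 ≤ d := sq_nonneg _
    have hBP : 0 < B * y n ^ γ := mul_pos hB (hPpos n)
    have h4 : B * y n ^ γ * ((1 - ε) * (γ * d)) ≤ B * y n ^ γ * (2 * ε * (γ + 1)) := by
      simp only [hM] at h2 h3
      linarith
    have h5 := le_of_mul_le_mul_left h4 hBP
    have h6 : γ * d < γ * c := by nlinarith [mul_nonneg hγ.le hd]
    exact lt_of_mul_lt_mul_left h6 hγ.le
  have habs : Tendsto (fun n => √(y n / v n) - 1) atTop (𝓝 0) := by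
    rw [tendsto_zero_iff_abs_tendsto_zero]
    simpa [Function.comp_def, Real.sqrt_sq_eq_abs] using hsq.sqrt
  have hsqrt := (habs.add_const 1).pow 2
  simp only [sub_add_cancel, zero_add, one_pow] at hsqrt
  exact hsqrt.congr fun n => Real.sq_sqrt (div_pos (hypos n) (hv n)).le
end

section
/- Let (Ω, F, P) be a probability space, T > 0, γ ∈ [1,2), and let (Z_t)_{t ∈ [0,T]} be a real-valued Gaussian process with continuous sample paths (all finite-dimensional distributions are Gaussian). Suppose there are a bounded function L : (0,T) → ℝ and a function C_γ^{(Z)} : ℝ² → ℝ homogeneous of order γ such that, uniformly over t ∈ (0,T), E[(Z_{t+r} − Z_t)(Z_{t+s} − Z_t)] = L(t)·C_γ^{(Z)}(r,s) + o((r² + s²)^{γ/2}) as (r,s) → (0,0), i.e., sup_{t ∈ (0,T)} (r² + s²)^{−γ/2}·| E[(Z_{t+r} − Z_t)(Z_{t+s} − Z_t)] − L(t)C_γ^{(Z)}(r,s) | → 0. Fix τ ∈ (0,T) and f ∈ C²(ℝ), and assume: (a) E[(Z_{τ+r} − Z_τ)·Z_τ] = O(|r|) and E[Z_{τ+r}]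 − E[Z_τ] = O(|r|) as r → 0; (b) E[(f′(Z_τ))⁴] < ∞ and E[ sup_{t ∈ (τ−ε, τ+ε)} (f″(Z_t))⁴ ] < ∞ for some ε > 0. Then the process V_t := f(Z_t) satisfies E[(V_{τ+r} − V_τ)(V_{τ+s} − V_τ)] = E[(f′(Z_τ))²]·L(τ)·C_γ^{(Z)}(r,s) + o((r² + s²)^{γ/2}) as (r,s) → (0,0). -/
open MeasureTheory ProbabilityTheory Set Filter Topology Asymptotics
open scoped NNReal

theorem abs_taylor_one_remainder_le {f : ℝ → ℝ} (hf : ContDiff ℝ 2 f) {a b K : ℝ}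
    (hK : ∀ y ∈ uIcc a b, |deriv (deriv f) y| ≤ K) :
    |f b - f a - deriv f a * (b - a)| ≤ K * (b - a) ^ 2 := by
  have hd : Differentiable ℝ f := hf.differentiable (by norm_num)
  have hd' : Differentiable ℝ (deriv f) :=
    ((contDiff_succ_iff_deriv (n := 1)).1 hf).2.2.differentiable (by norm_num)
  have hK0 : 0 ≤ K := (abs_nonneg _).trans (hK a left_mem_uIcc)
  have h1 : ∀ y ∈ uIcc a b, ‖deriv f y - deriv f a‖ ≤ K * |b - a| := fun y hy =>
    ((convex_uIcc a b).norm_image_sub_le_of_norm_deriv_le (fun x _ => hd' x) hK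
      left_mem_uIcc hy).trans
      (mul_le_mul_of_nonneg_left (abs_sub_left_of_mem_uIcc hy) hK0)
  have h2 := (convex_uIcc a b).norm_image_sub_le_of_norm_hasDerivWithin_le
    (f := fun y => f y - deriv f a * y) (f' := fun y => deriv f y - deriv f a)
    (fun y _ => by
      simpa using ((hd y).hasDerivAt.fun_sub ((hasDerivAt_id y).const_mul (deriv f a))).hasDerivWithinAt)
    h1 left_mem_uIcc right_mem_uIcc
  rw [Real.norm_eq_abs, Real.norm_eq_abs] at h2
  calc _ = |f b - deriv f a * b - (f a - deriv f a * a)| := by congr 1; ring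
    _ ≤ K * |b - a| * |b - a| := h2
    _ = K * (b - a) ^ 2 := by rw [mul_assoc, abs_mul_abs_self]; ring

theorem abs_path_taylor_remainder_le {f z : ℝ → ℝ} (hf : ContDiff ℝ 2 f) {τ r K : ℝ}
    (hz : ContinuousOn z (uIcc τ (τ + r)))
    (hK : ∀ t ∈ uIcc τ (τ + r), |deriv (deriv f) (z t)| ≤ K) :
    |f (z (τ + r)) - f (z τ) - deriv f (z τ) * (z (τ + r) - z τ)| ≤
      K * (z (τ + r) - z τ) ^ 2 := by
  refine abs_taylor_one_remainder_le hf fun y hy => ?_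
  obtain ⟨t, ht, rfl⟩ := intermediate_value_uIcc hz hy
  exact hK t ht

/-- Eighth moments of real Gaussian variables are controlled by second moments. -/
theorem exists_integral_pow_eight_le : ∃ K : ℝ, 0 ≤ K ∧ ∀ {Ω : Type*} [MeasurableSpace Ω]
    (P : Measure Ω) [IsProbabilityMeasure P] (U : Ω → ℝ), HasGaussianLaw U P →
      ∫ ω, U ω ^ 8 ∂P ≤ K * (∫ ω, U ω ^ 2 ∂P) ^ 4 := by
  refine ⟨∫ x, (1 + x ^ 2) ^ 4 ∂(gaussianReal 0 1), integral_nonneg fun x => by positivity,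
    fun P _ U hU => ?_⟩
  set m := ∫ ω, U ω ∂P
  set σ := √(Var[U; P])
  have hσ : σ ^ 2 = Var[U; P] := Real.sq_sqrt (variance_nonneg _ _)
  have hmap : P.map U = (gaussianReal 0 1).map (fun x => m + σ * x) := by
    rw [hU.map_eq_gaussianReal]
    have : (fun x => m + σ * x) = (fun x => m + x) ∘ (fun x => σ * x) := rfl
    rw [this, ← Measure.map_map (by fun_prop) (by fun_prop), gaussianReal_map_const_mul,
      gaussianReal_map_const_add]
    congr 1
    · simp [m]
    · ext
      simp [hσ, variance_nonneg]
  have h2 : ∫ ω, U ω ^ 2 ∂P = m ^ 2 + σ ^ 2 := by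
    rw [hσ, variance_eq_sub hU.memLp_two]
    simp [m]
  have h8 : ∫ ω, U ω ^ 8 ∂P = ∫ x, (m + σ * x) ^ 8 ∂(gaussianReal 0 1) := by
    rw [← integral_map (f := fun x => x ^ 8) hU.aemeasurable (by fun_prop), hmap,
      integral_map (by fun_prop) (by fun_prop)]
  have hid : ∀ p : ℝ≥0, MemLp (fun x : ℝ => x) p (gaussianReal 0 1) := memLp_id_gaussianReal
  have hint : ∀ n : ℕ, Integrable (fun x : ℝ => x ^ n) (gaussianReal 0 1) := fun n => by
    have := (hid n).integrable_norm_pow'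
    refine this.mono' (by fun_prop) (ae_of_all _ fun x => by simp)
  rw [h2, h8, mul_comm, ← integral_const_mul]
  refine integral_mono_of_nonneg (ae_of_all _ fun x => by positivity) ?_
    (ae_of_all _ fun x => ?_)
  · refine Integrable.const_mul ?_ _
    have : (fun x : ℝ => (1 + x ^ 2) ^ 4) =
      fun x => 1 + 4 * x ^ 2 + 6 * x ^ 4 + 4 * x ^ 6 + x ^ 8 := by funext x; ring
    rw [this]
    exact (((((integrable_const _).add ((hint 2).const_mul 4)).add ((hint 4).const_mul 6)).add
      ((hint 6).const_mul 4)).add (hint 8))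
  · show (m + σ * x) ^ 8 ≤ (m ^ 2 + σ ^ 2) ^ 4 * (1 + x ^ 2) ^ 4
    rw [← mul_pow, show (m + σ * x) ^ 8 = ((m + σ * x) ^ 2) ^ 4 by ring]
    gcongr
    nlinarith [sq_nonneg (m * x - σ)]

theorem mul_mul_mul_le_add_pow_four (a b c d : ℝ) :
    a * b * c * d ≤ a ^ 4 + b ^ 4 + c ^ 4 + d ^ 4 := by
  nlinarith [sq_nonneg (a * b - c * d), sq_nonneg (a ^ 2 - b ^ 2), sq_nonneg (c ^ 2 - d ^ 2),
    sq_nonneg (a * b), sq_nonneg (c * d), sq_nonneg (a ^ 2), sq_nonneg (b ^ 2),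
    sq_nonneg (c ^ 2), sq_nonneg (d ^ 2)]

/-- Replacing first-order Taylor increments by their linear parts in a product, with all
quantities rescaled by `κ`. -/
theorem abs_mul_sub_linear_mul_linear_le {A B g u v k κ : ℝ} (hκ0 : 0 ≤ κ) (hκ1 : κ ≤ 1)
    (hk : 0 ≤ k)
    (hA : |A - g * (κ * u)| ≤ k * (κ * u) ^ 2) (hB : |B - g * (κ * v)| ≤ k * (κ * v) ^ 2) :
    |A * B - g ^ 2 * ((κ * u) * (κ * v))| ≤
      κ ^ 3 * (4 * (1 + g ^ 4 + k ^ 4 + u ^ 8 + v ^ 8)) := by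
  have h4 : ∀ x : ℝ, x ^ 4 ≤ 1 + x ^ 8 := fun x => by nlinarith [sq_nonneg (x ^ 4 - 1)]
  have e : A * B - g ^ 2 * ((κ * u) * (κ * v)) = g * (κ * u) * (B - g * (κ * v)) +
      g * (κ * v) * (A - g * (κ * u)) + (A - g * (κ * u)) * (B - g * (κ * v)) := by ring
  have a1 : |g * (κ * u) * (B - g * (κ * v))| ≤ κ ^ 3 * (|g| * |u| * k * v ^ 2) := by
    rw [abs_mul, abs_mul, abs_mul, abs_of_nonneg hκ0]
    calc _ ≤ |g| * (κ * |u|) * (k * (κ * v) ^ 2) := by gcongr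
      _ = _ := by ring
  have a2 : |g * (κ * v) * (A - g * (κ * u))| ≤ κ ^ 3 * (|g| * |v| * k * u ^ 2) := by
    rw [abs_mul, abs_mul, abs_mul, abs_of_nonneg hκ0]
    calc _ ≤ |g| * (κ * |v|) * (k * (κ * u) ^ 2) := by gcongr
      _ = _ := by ring
  have a3 : |(A - g * (κ * u)) * (B - g * (κ * v))| ≤ κ ^ 3 * (k * (u ^ 2) * (v ^ 2) * k) := by
    rw [abs_mul]
    calc _ ≤ (k * (κ * u) ^ 2) * (k * (κ * v) ^ 2) := by gcongr
      _ = κ ^ 3 * (k * (u ^ 2) * (v ^ 2) * k) * κ := by ring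
      _ ≤ κ ^ 3 * (k * (u ^ 2) * (v ^ 2) * k) * 1 := by gcongr
      _ = _ := mul_one _
  have b1 := mul_mul_mul_le_add_pow_four |g| |u| k (v ^ 2)
  have b2 := mul_mul_mul_le_add_pow_four |g| |v| k (u ^ 2)
  have b3 := mul_mul_mul_le_add_pow_four k (u ^ 2) (v ^ 2) k
  have ev : ∀ x : ℝ, |x| ^ 4 = x ^ 4 := fun x => by
    rw [show |x| ^ 4 = (|x| ^ 2) ^ 2 by ring, sq_abs]; ring
  have e8 : ∀ x : ℝ, (x ^ 2) ^ 4 = x ^ 8 := fun x => by ring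
  rw [ev, ev, e8] at b1 b2
  rw [e8, e8] at b3
  rw [e]
  refine (abs_add_three _ _ _).trans ?_
  refine (add_le_add (add_le_add a1 a2) a3).trans ?_
  rw [← mul_add, ← mul_add]
  gcongr
  have := h4 u
  have := h4 v
  have : 0 ≤ g ^ 4 := by positivity
  have : 0 ≤ k ^ 4 := by positivity
  have : 0 ≤ u ^ 8 := by positivity
  have : 0 ≤ v ^ 8 := by positivity
  linarith

theorem holderTriple_four_four_two : ENNReal.HolderTriple 4 4 2 := ⟨by
  rw [← two_mul, show (4 : ENNReal) = 2 * 2 by norm_num,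
    ENNReal.mul_inv (by simp) (by simp), ← mul_assoc,
    ENNReal.mul_inv_cancel (by simp) (by simp), one_mul]⟩

/-- The linear regression of `U` on `X`, as a function of the value of `X`. -/
noncomputable def linearRegression {Ω : Type*} [MeasurableSpace Ω] (P : Measure Ω)
    (X U : Ω → ℝ) (x : ℝ) : ℝ :=
  ∫ ω, U ω ∂P + cov[U, X; P] / Var[X; P] * (x - ∫ ω, X ω ∂P)

theorem measurable_linearRegression {Ω : Type*} [MeasurableSpace Ω] (P : Measure Ω)
    (X U : Ω → ℝ) : Measurable (linearRegression P X U) := by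
  unfold linearRegression
  fun_prop

theorem covariance_sub_regression_eq_zero {Ω : Type*} [MeasurableSpace Ω] {P : Measure Ω}
    [IsProbabilityMeasure P] {X U : Ω → ℝ} (hX : MemLp X 2 P) (hU : MemLp U 2 P) :
    cov[X, fun ω => U ω - cov[U, X; P] / Var[X; P] * X ω; P] = 0 := by
  rw [covariance_fun_sub_right hX hU (hX.const_mul _), covariance_const_mul_right,
    covariance_self hX.aemeasurable]
  by_cases h0 : Var[X; P] = 0
  · have hc : X =ᵐ[P] fun _ => ∫ ω, X ω ∂P :=
      ae_eq_integral_of_variance_eq_zero hX h0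
    rw [h0]
    simp only [mul_zero, sub_zero]
    rw [covariance]
    apply integral_eq_zero_of_ae
    filter_upwards [hc] with ω hω
    simp [hω]
  · rw [covariance_comm U X]
    field_simp
    ring

theorem hasGaussianLaw_of_forall_linear {Ω : Type*} [MeasurableSpace Ω] {P : Measure Ω}
    [IsProbabilityMeasure P] {X U V : Ω → ℝ}
    (hX : Measurable X) (hU : Measurable U) (hV : Measurable V)
    (hG : ∀ a b c : ℝ, HasGaussianLaw (fun ω => a * X ω + b * U ω + c * V ω) P) :
    HasGaussianLaw (fun ω => (X ω, (U ω, V ω))) P := by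
  refine ⟨⟨fun L => ?_⟩⟩
  have hm : Measurable (fun ω => (X ω, (U ω, V ω))) := by fun_prop
  have hL : Measurable L := L.continuous.measurable
  have hcomp : (fun ω => L (X ω, (U ω, V ω))) =
      fun ω => L (1, 0, 0) * X ω + L (0, 1, 0) * U ω + L (0, 0, 1) * V ω := by
    funext ω
    have : (X ω, (U ω, V ω)) = X ω • ((1, 0, 0) : ℝ × ℝ × ℝ) + U ω • ((0, 1, 0) : ℝ × ℝ × ℝ)
        + V ω • ((0, 0, 1) : ℝ × ℝ × ℝ) := by simp
    rw [this]
    simp only [map_add, map_smul, smul_eq_mul]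
    ring
  have hlaw := (hG (L (1, 0, 0)) (L (0, 1, 0)) (L (0, 0, 1)))
  rw [← hcomp] at hlaw
  rw [Measure.map_map hL hm, integral_map hm.aemeasurable hL.aestronglyMeasurable,
    variance_map hL.aemeasurable hm.aemeasurable]
  exact hlaw.map_eq_gaussianReal

theorem indepFun_sub_regression {Ω : Type*} [MeasurableSpace Ω] {P : Measure Ω}
    [IsProbabilityMeasure P] {X U V : Ω → ℝ}
    (hX : Measurable X) (hU : Measurable U) (hV : Measurable V)
    (hG : ∀ a b c : ℝ, HasGaussianLaw (fun ω => a * X ω + b * U ω + c * V ω) P) :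
    IndepFun X (fun ω => (U ω - linearRegression P X U (X ω),
      V ω - linearRegression P X V (X ω))) P := by
  have hX2 : MemLp X 2 P := by simpa using (hG 1 0 0).memLp_two
  have hU2 : MemLp U 2 P := by simpa using (hG 0 1 0).memLp_two
  have hV2 : MemLp V 2 P := by simpa using (hG 0 0 1).memLp_two
  set p := cov[U, X; P] / Var[X; P] with hp
  set q := cov[V, X; P] / Var[X; P] with hq
  have hlaw : HasGaussianLaw (fun ω => (X ω, (U ω - p * X ω, V ω - q * X ω))) P := by
    refine hasGaussianLaw_of_forall_linear hX (by fun_prop) (by fun_prop) fun a b c => ?_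
    convert hG (a - b * p - c * q) b c using 2
    ring
  have hi : IndepFun X (fun ω => (U ω - p * X ω, V ω - q * X ω)) P := by
    refine hlaw.indepFun_of_covariance_strongDual fun L₁ L₂ => ?_
    have h1 : L₁ ∘ X = fun ω => L₁ 1 * X ω := by
      funext ω
      have := L₁.map_smul (X ω) 1
      simp only [smul_eq_mul, mul_one] at this
      simp [this, mul_comm]
    have h2 : L₂ ∘ (fun ω => (U ω - p * X ω, V ω - q * X ω)) =
        fun ω => L₂ (1, 0) * (U ω - p * X ω) + L₂ (0, 1) * (V ω - q * X ω) := by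
      funext ω
      have : (U ω - p * X ω, V ω - q * X ω) = (U ω - p * X ω) • ((1, 0) : ℝ × ℝ)
          + (V ω - q * X ω) • ((0, 1) : ℝ × ℝ) := by simp
      simp only [Function.comp_apply]
      rw [this]
      simp only [map_add, map_smul, smul_eq_mul]
      ring
    rw [h1, h2, covariance_const_mul_left]
    have hadd := covariance_add_right (μ := P) hX2
      ((hU2.sub (hX2.const_mul p)).const_mul (L₂ (1, 0)))
      ((hV2.sub (hX2.const_mul q)).const_mul (L₂ (0, 1)))
    refine mul_eq_zero_of_right _ (hadd.trans ?_)
    have e1 := covariance_sub_regression_eq_zero hX2 hU2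
    have e2 := covariance_sub_regression_eq_zero hX2 hV2
    have f1 := covariance_const_mul_right (μ := P) (X := X) (Y := fun ω => U ω - p * X ω)
      (L₂ (1, 0))
    have f2 := covariance_const_mul_right (μ := P) (X := X) (Y := fun ω => V ω - q * X ω)
      (L₂ (0, 1))
    rw [e1, mul_zero] at f1
    rw [e2, mul_zero] at f2
    exact (congrArg₂ (· + ·) f1 f2).trans (add_zero 0)
  have hφ : Measurable fun z : ℝ × ℝ =>
      (z.1 - (∫ ω, U ω ∂P - p * ∫ ω, X ω ∂P), z.2 - (∫ ω, V ω ∂P - q * ∫ ω, X ω ∂P)) := by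
    fun_prop
  have hc := hi.comp measurable_id hφ
  have he : (fun ω => (U ω - linearRegression P X U (X ω), V ω - linearRegression P X V (X ω))) =
      (fun z : ℝ × ℝ => (z.1 - (∫ ω, U ω ∂P - p * ∫ ω, X ω ∂P),
        z.2 - (∫ ω, V ω ∂P - q * ∫ ω, X ω ∂P))) ∘ fun ω => (U ω - p * X ω, V ω - q * X ω) := by
    funext ω
    refine Prod.ext ?_ ?_
    · simp only [linearRegression, Function.comp_apply, ← hp]
      ring
    · simp only [linearRegression, Function.comp_apply, ← hq]
      ring
  rw [he]
  exact hc

theorem integral_sub_linearRegression {Ω : Type*} [MeasurableSpace Ω] {P : Measure Ω}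
    [IsProbabilityMeasure P] {X U : Ω → ℝ} (hX : Integrable X P) (hU : Integrable U P) :
    ∫ ω, (U ω - linearRegression P X U (X ω)) ∂P = 0 := by
  unfold linearRegression
  rw [integral_sub hU (by fun_prop), integral_add (by fun_prop) (by fun_prop),
    integral_const_mul, integral_sub hX (by fun_prop)]
  simp

theorem integral_comp_mul_mul_eq_of_indepFun {Ω : Type*} [MeasurableSpace Ω] {P : Measure Ω}
    [IsProbabilityMeasure P] {X U V : Ω → ℝ} (hX : Measurable X) (hU : Measurable U)
    (hV : Measurable V) {h l m : ℝ → ℝ} (hh : Measurable h) (hl : Measurable l)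
    (hm : Measurable m) (hh2 : MemLp (fun ω => h (X ω)) 2 P) (hh0 : ∫ ω, h (X ω) ∂P = 0)
    (hl4 : MemLp (fun ω => l (X ω)) 4 P) (hm4 : MemLp (fun ω => m (X ω)) 4 P)
    (hU4 : MemLp U 4 P) (hV4 : MemLp V 4 P) (hU0 : ∫ ω, U ω ∂P = 0) (hV0 : ∫ ω, V ω ∂P = 0)
    (hind : IndepFun X (fun ω => (U ω, V ω)) P) :
    ∫ ω, h (X ω) * ((l (X ω) + U ω) * (m (X ω) + V ω)) ∂P =
      ∫ ω, h (X ω) * (l (X ω) * m (X ω)) ∂P := by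
  have hholder := holderTriple_four_four_two
  have hprod : ∀ {A B : Ω → ℝ}, MemLp A 4 P → MemLp B 4 P →
      Integrable (fun ω => h (X ω) * (A ω * B ω)) P := fun {A B} hA hB =>
    hh2.integrable_mul (MemLp.mul (r := 2) hB hA)
  have i1 := hprod hl4 hm4
  have i2 := hprod hl4 hV4
  have i3 := hprod hm4 hU4
  have i4 := hprod hU4 hV4
  have i12 : Integrable (fun ω => h (X ω) * (l (X ω) * m (X ω)) + h (X ω) * (l (X ω) * V ω)) P :=
    i1.add i2
  have i123 : Integrable (fun ω => h (X ω) * (l (X ω) * m (X ω)) + h (X ω) * (l (X ω) * V ω) +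
      h (X ω) * (m (X ω) * U ω)) P := i12.add i3
  have key : ∀ (φ : ℝ → ℝ) (ψ : ℝ × ℝ → ℝ), Measurable φ → Measurable ψ →
      ∫ ω, φ (X ω) * ψ (U ω, V ω) ∂P = (∫ ω, φ (X ω) ∂P) * ∫ ω, ψ (U ω, V ω) ∂P :=
    fun φ ψ hφ hψ => (hind.comp hφ hψ).integral_fun_mul_eq_mul_integral
      (hφ.comp hX).aestronglyMeasurable (hψ.comp (hU.prodMk hV)).aestronglyMeasurable
  have z2 : ∫ ω, h (X ω) * (l (X ω) * V ω) ∂P = 0 := by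
    simp_rw [← mul_assoc]
    rw [key (fun x => h x * l x) Prod.snd (hh.mul hl) measurable_snd, hV0, mul_zero]
  have z3 : ∫ ω, h (X ω) * (m (X ω) * U ω) ∂P = 0 := by
    simp_rw [← mul_assoc]
    rw [key (fun x => h x * m x) Prod.fst (hh.mul hm) measurable_fst, hU0, mul_zero]
  have z4 : ∫ ω, h (X ω) * (U ω * V ω) ∂P = 0 := by
    rw [key h (fun z => z.1 * z.2) hh (measurable_fst.mul measurable_snd), hh0, zero_mul]
  calc ∫ ω, h (X ω) * ((l (X ω) + U ω) * (m (X ω) + V ω)) ∂P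
      = ∫ ω, (h (X ω) * (l (X ω) * m (X ω)) + h (X ω) * (l (X ω) * V ω) +
        h (X ω) * (m (X ω) * U ω) + h (X ω) * (U ω * V ω)) ∂P := by
        congr 1 with ω
        ring
    _ = _ := by
        rw [integral_add i123 i4, integral_add i12 i3, integral_add i1 i2, z2, z3, z4]
        simp

/-- If `X, U, V` are jointly Gaussian and `h(X)` is square integrable and centred, then in
`E[h(X) U V]` the variables `U` and `V` can be replaced by their regressions on `X`. -/
theorem integral_comp_mul_mul_eq_regression {Ω : Type*} [MeasurableSpace Ω] {P : Measure Ω}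
    [IsProbabilityMeasure P] {X U V : Ω → ℝ}
    (hX : Measurable X) (hU : Measurable U) (hV : Measurable V)
    (hG : ∀ a b c : ℝ, HasGaussianLaw (fun ω => a * X ω + b * U ω + c * V ω) P)
    {h : ℝ → ℝ} (hh : Measurable h) (hh2 : MemLp (fun ω => h (X ω)) 2 P)
    (hh0 : ∫ ω, h (X ω) ∂P = 0) :
    ∫ ω, h (X ω) * (U ω * V ω) ∂P =
      ∫ ω, h (X ω) * (linearRegression P X U (X ω) * linearRegression P X V (X ω)) ∂P := by
  have hXp : MemLp X 4 P := by simpa using (hG 1 0 0).memLp (p := 4) (by simp)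
  have hUp : MemLp U 4 P := by simpa using (hG 0 1 0).memLp (p := 4) (by simp)
  have hVp : MemLp V 4 P := by simpa using (hG 0 0 1).memLp (p := 4) (by simp)
  have hreg : ∀ W : Ω → ℝ, MemLp (fun ω => linearRegression P X W (X ω)) 4 P := by
    intro W
    unfold linearRegression
    exact (memLp_const (∫ ω, W ω ∂P)).add
      ((hXp.sub (memLp_const (∫ ω, X ω ∂P))).const_mul (cov[W, X; P] / Var[X; P]))
  have hint : ∀ {W : Ω → ℝ}, MemLp W 4 P → Integrable W P := fun hW =>
    hW.integrable (by norm_num)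
  have hmU := measurable_linearRegression P X U
  have hmV := measurable_linearRegression P X V
  have hUm : Measurable fun ω => U ω - linearRegression P X U (X ω) := hU.sub (hmU.comp hX)
  have hVm : Measurable fun ω => V ω - linearRegression P X V (X ω) := hV.sub (hmV.comp hX)
  have hU4 : MemLp (fun ω => U ω - linearRegression P X U (X ω)) 4 P := hUp.sub (hreg U)
  have hV4 : MemLp (fun ω => V ω - linearRegression P X V (X ω)) 4 P := hVp.sub (hreg V)
  have := integral_comp_mul_mul_eq_of_indepFun hX hUm hVm hh hmU hmV hh2 hh0 (hreg U) (hreg V)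
    hU4 hV4 (integral_sub_linearRegression (hint hXp) (hint hUp))
    (integral_sub_linearRegression (hint hXp) (hint hVp))
    (indepFun_sub_regression hX hU hV hG)
  simpa only [add_sub_cancel] using this

/-- Pairs of increments of a Gaussian family that decorrelate linearly from `X` are
asymptotically uncorrelated from functions of `X`, up to the product of the step sizes. -/
theorem isBigO_integral_comp_mul_increments {Ω : Type*} [MeasurableSpace Ω] {P : Measure Ω}
    [IsProbabilityMeasure P] {X : Ω → ℝ} {U : ℝ → Ω → ℝ} (hX : Measurable X)
    (hU : ∀ r, Measurable (U r))
    (hG : ∀ r s a b c : ℝ, HasGaussianLaw (fun ω => a * X ω + b * U r ω + c * U s ω) P)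
    (hUX : (fun r => ∫ ω, U r ω * X ω ∂P) =O[𝓝 (0 : ℝ)] fun r => r)
    (hU1 : (fun r => ∫ ω, U r ω ∂P) =O[𝓝 (0 : ℝ)] fun r => r)
    {g : ℝ → ℝ} (hg : Measurable g) (hg2 : MemLp (fun ω => g (X ω)) 2 P) :
    (fun p : ℝ × ℝ => ∫ ω, g (X ω) * (U p.1 ω * U p.2 ω) ∂P -
        (∫ ω, g (X ω) ∂P) * ∫ ω, U p.1 ω * U p.2 ω ∂P)
      =O[𝓝 (0 : ℝ × ℝ)] fun p : ℝ × ℝ => p.1 * p.2 := by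
  have hX4 : MemLp X 4 P := by simpa using (hG 0 0 1 0 0).memLp (p := 4) (by simp)
  have hX2 : MemLp X 2 P := by simpa using (hG 0 0 1 0 0).memLp (p := 2) (by simp)
  have hU2 : ∀ r, MemLp (U r) 2 P := fun r => by
    simpa using (hG r 0 0 1 0).memLp (p := 2) (by simp)
  have hU4 : ∀ r, MemLp (U r) 4 P := fun r => by
    simpa using (hG r 0 0 1 0).memLp (p := 4) (by simp)
  have hholder := holderTriple_four_four_two
  have hcov : (fun r => cov[U r, X; P] / Var[X; P]) =O[𝓝 (0 : ℝ)] fun r => r := by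
    have h1 : (fun r => cov[U r, X; P]) = fun r =>
        ∫ ω, U r ω * X ω ∂P - (∫ ω, X ω ∂P) * ∫ ω, U r ω ∂P := by
      funext r
      rw [covariance_eq_sub (hU2 r) hX2, mul_comm (∫ ω, X ω ∂P)]
      rfl
    simp_rw [div_eq_inv_mul]
    refine IsBigO.const_mul_left ?_ _
    rw [h1]
    exact hUX.sub (hU1.const_mul_left _)
  obtain ⟨c₁, hc₁, h₁⟩ := hU1.exists_pos
  obtain ⟨c₂, hc₂, h₂⟩ := hcov.exists_pos
  set m := ∫ ω, X ω ∂P with hm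
  set c := max c₁ c₂
  have hreg : ∀ᶠ r in 𝓝 (0 : ℝ), ∀ x, |linearRegression P X (U r) x| ≤
      c * |r| * (1 + |x - m|) := by
    filter_upwards [h₁.bound, h₂.bound] with r hr1 hr2 x
    rw [Real.norm_eq_abs, Real.norm_eq_abs] at hr1 hr2
    calc |linearRegression P X (U r) x|
        ≤ |∫ ω, U r ω ∂P| + |cov[U r, X; P] / Var[X; P]| * |x - m| := by
          rw [← abs_mul]; exact abs_add_le _ _
      _ ≤ c * |r| + c * |r| * |x - m| := by
          gcongr
          · exact hr1.trans (by gcongr; exact le_max_left _ _)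
          · exact hr2.trans (by gcongr; exact le_max_right _ _)
      _ = _ := by ring
  set e := ∫ ω, g (X ω) ∂P with he
  have hh2 : MemLp (fun ω => g (X ω) - e) 2 P := hg2.sub (memLp_const e)
  have hh0 : ∫ ω, (g (X ω) - e) ∂P = 0 := by
    rw [integral_sub (hg2.integrable (by norm_num)) (integrable_const _)]
    simp [he]
  have hD4 : MemLp (fun ω => 1 + |X ω - m|) 4 P :=
    (memLp_const (1 : ℝ)).add ((hX4.sub (memLp_const m)).norm)
  have hDint : Integrable (fun ω => |g (X ω) - e| * ((1 + |X ω - m|) * (1 + |X ω - m|))) P :=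
    MemLp.integrable_mul hh2.norm (MemLp.mul (r := 2) hD4 hD4)
  refine IsBigO.of_bound
    (c * c * ∫ ω, |g (X ω) - e| * ((1 + |X ω - m|) * (1 + |X ω - m|)) ∂P) ?_
  have hfst : Tendsto (Prod.fst : ℝ × ℝ → ℝ) (𝓝 0) (𝓝 0) := continuous_fst.tendsto' _ _ rfl
  have hsnd : Tendsto (Prod.snd : ℝ × ℝ → ℝ) (𝓝 0) (𝓝 0) := continuous_snd.tendsto' _ _ rfl
  filter_upwards [hfst.eventually hreg, hsnd.eventually hreg] with p hp1 hp2
  have hUU4 : MemLp (fun ω => U p.1 ω * U p.2 ω) 2 P := MemLp.mul (r := 2) (hU4 p.2) (hU4 p.1)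
  have i1 : Integrable (fun ω => g (X ω) * (U p.1 ω * U p.2 ω)) P := hg2.integrable_mul hUU4
  have i2 : Integrable (fun ω => e * (U p.1 ω * U p.2 ω)) P :=
    (hUU4.integrable (by norm_num)).const_mul e
  have hrepl : ∫ ω, g (X ω) * (U p.1 ω * U p.2 ω) ∂P - e * ∫ ω, U p.1 ω * U p.2 ω ∂P =
      ∫ ω, (g (X ω) - e) * (linearRegression P X (U p.1) (X ω) *
        linearRegression P X (U p.2) (X ω)) ∂P := by
    rw [← integral_const_mul, ← integral_sub i1 i2,
      ← integral_comp_mul_mul_eq_regression hX (hU p.1) (hU p.2) (hG p.1 p.2)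
        (h := fun x => g x - e) (hg.sub_const e) hh2 hh0]
    congr 1 with ω
    ring
  rw [hrepl]
  have hb : ∫ ω, c * c * ‖p.1 * p.2‖ *
      (|g (X ω) - e| * ((1 + |X ω - m|) * (1 + |X ω - m|))) ∂P =
      c * c * (∫ ω, |g (X ω) - e| * ((1 + |X ω - m|) * (1 + |X ω - m|)) ∂P) * ‖p.1 * p.2‖ := by
    rw [integral_const_mul]
    ring
  rw [← hb]
  refine norm_integral_le_of_norm_le (hDint.const_mul _) (ae_of_all _ fun ω => ?_)
  rw [Real.norm_eq_abs, Real.norm_eq_abs, abs_mul, abs_mul, abs_mul]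
  calc |g (X ω) - e| * (|linearRegression P X (U p.1) (X ω)| *
        |linearRegression P X (U p.2) (X ω)|)
      ≤ |g (X ω) - e| * ((c * |p.1| * (1 + |X ω - m|)) * (c * |p.2| * (1 + |X ω - m|))) := by
        gcongr
        · exact hp1 _
        · exact hp2 _
    _ = _ := by ring

/-- Integrated form of the replacement of first-order Taylor increments by their linear
parts in a product. -/
theorem abs_integral_mul_sub_linear_mul_linear_le {Ω : Type*} [MeasurableSpace Ω] {P : Measure Ω}
    [IsProbabilityMeasure P] {A A' g U V k : Ω → ℝ} {κ B : ℝ} (hκ0 : 0 < κ) (hκ1 : κ ≤ 1)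
    (hA : Measurable A) (hA' : Measurable A') (hg : Measurable g) (hU : Measurable U)
    (hV : Measurable V) (hk : ∀ ω, 0 ≤ k ω)
    (hAU : ∀ ω, |A ω - g ω * U ω| ≤ k ω * U ω ^ 2)
    (hAV : ∀ ω, |A' ω - g ω * V ω| ≤ k ω * V ω ^ 2)
    (hg4 : Integrable (fun ω => g ω ^ 4) P) (hk4 : Integrable (fun ω => k ω ^ 4) P)
    (hU8 : Integrable (fun ω => U ω ^ 8) P) (hV8 : Integrable (fun ω => V ω ^ 8) P)
    (hUB : ∫ ω, U ω ^ 8 ∂P ≤ B * κ ^ 8) (hVB : ∫ ω, V ω ^ 8 ∂P ≤ B * κ ^ 8) :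
    |∫ ω, A ω * A' ω ∂P - ∫ ω, g ω ^ 2 * (U ω * V ω) ∂P| ≤
      κ ^ 3 * (4 * (1 + ∫ ω, g ω ^ 4 ∂P + ∫ ω, k ω ^ 4 ∂P + B + B)) := by
  have hpt : ∀ ω, |A ω * A' ω - g ω ^ 2 * (U ω * V ω)| ≤
      κ ^ 3 * (4 * (1 + g ω ^ 4 + k ω ^ 4 + U ω ^ 8 / κ ^ 8 + V ω ^ 8 / κ ^ 8)) := fun ω => by
    have hu : κ * (U ω / κ) = U ω := mul_div_cancel₀ _ hκ0.ne'
    have hv : κ * (V ω / κ) = V ω := mul_div_cancel₀ _ hκ0.ne'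
    have := abs_mul_sub_linear_mul_linear_le (A := A ω) (B := A' ω) (g := g ω) (u := U ω / κ)
      (v := V ω / κ) hκ0.le hκ1 (hk ω) (by rw [hu]; exact hAU ω) (by rw [hv]; exact hAV ω)
    rwa [hu, hv, div_pow, div_pow] at this
  have j1 : Integrable (fun ω => 1 + g ω ^ 4) P := (integrable_const 1).add hg4
  have j2 : Integrable (fun ω => 1 + g ω ^ 4 + k ω ^ 4) P := j1.add hk4
  have j3 : Integrable (fun ω => 1 + g ω ^ 4 + k ω ^ 4 + U ω ^ 8 / κ ^ 8) P :=
    j2.add (hU8.div_const _)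
  have j4 : Integrable (fun ω => 1 + g ω ^ 4 + k ω ^ 4 + U ω ^ 8 / κ ^ 8 + V ω ^ 8 / κ ^ 8) P :=
    j3.add (hV8.div_const _)
  have hbound := (j4.const_mul 4).const_mul (κ ^ 3)
  have i1 : Integrable (fun ω => g ω ^ 2 * (U ω * V ω)) P := by
    have hdom : Integrable (fun ω => 2 * g ω ^ 4 + 2 + U ω ^ 8 + V ω ^ 8) P :=
      (((hg4.const_mul 2).add (integrable_const 2)).add hU8).add hV8
    refine hdom.mono' (by fun_prop) (ae_of_all _ fun ω => ?_)
    have h := mul_mul_mul_le_add_pow_four |g ω| |g ω| |U ω| |V ω|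
    have ev : ∀ x : ℝ, |x| ^ 4 = x ^ 4 := fun x => by
      rw [show |x| ^ 4 = (|x| ^ 2) ^ 2 by ring, sq_abs]; ring
    rw [ev, ev, ev] at h
    have h4 : ∀ x : ℝ, x ^ 4 ≤ 1 + x ^ 8 := fun x => by nlinarith [sq_nonneg (x ^ 4 - 1)]
    have e1 := h4 (U ω)
    have e2 := h4 (V ω)
    rw [Real.norm_eq_abs, abs_mul, abs_mul, abs_pow]
    linarith
  have i2 : Integrable (fun ω => A ω * A' ω - g ω ^ 2 * (U ω * V ω)) P :=
    hbound.mono' (by fun_prop) (ae_of_all _ hpt)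
  have i3 : Integrable (fun ω => A ω * A' ω) P :=
    (i2.add i1).congr (ae_of_all _ fun ω => sub_add_cancel _ _)
  rw [← integral_sub i3 i1]
  refine (norm_integral_le_of_norm_le (f := fun ω => A ω * A' ω - g ω ^ 2 * (U ω * V ω)) hbound
    (ae_of_all _ hpt)).trans ?_
  rw [integral_const_mul, integral_const_mul, integral_add j3 (hV8.div_const _),
    integral_add j2 (hU8.div_const _), integral_add j1 hk4, integral_add (integrable_const 1) hg4,
    integral_div, integral_div]
  have hκ8 : 0 < κ ^ 8 := by positivity
  have := (div_le_iff₀ hκ8).2 hUB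
  have := (div_le_iff₀ hκ8).2 hVB
  simp only [integral_const, probReal_univ, smul_eq_mul, one_mul]
  gcongr

/-- A diagonal expansion with a homogeneous leading term bounds second moments by a power. -/
theorem exists_eventually_le_mul_abs_rpow {v : ℝ → ℝ} {C : ℝ → ℝ → ℝ} {γ a : ℝ} (hγ : 0 < γ)
    (hv0 : v 0 = 0)
    (hhom : ∀ h : ℝ, 0 < h → ∀ r s : ℝ, C (h * r) (h * s) = h ^ γ * C r s)
    (hv : ∃ δ : ℝ, 0 < δ ∧ ∀ r : ℝ, r ≠ 0 → r ^ 2 + r ^ 2 < δ ^ 2 →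
      |v r - a * C r r| ≤ (r ^ 2 + r ^ 2) ^ (γ / 2)) :
    ∃ B : ℝ, 0 ≤ B ∧ ∀ᶠ r in 𝓝 (0 : ℝ), v r ≤ B * |r| ^ γ := by
  obtain ⟨δ, hδ, h⟩ := hv
  have hpow : ∀ r : ℝ, (r ^ 2 + r ^ 2) ^ (γ / 2) = 2 ^ (γ / 2) * |r| ^ γ := fun r => by
    rw [← two_mul, Real.mul_rpow (by norm_num) (by positivity), ← sq_abs, ← Real.rpow_natCast,
      ← Real.rpow_mul (abs_nonneg _)]
    congr 2
    push_cast
    ring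
  have hC : ∀ r : ℝ, r ≠ 0 → |C r r| ≤ |r| ^ γ * (|C 1 1| + |C (-1) (-1)|) := fun r hr => by
    have hr' : 0 < |r| := abs_pos.2 hr
    have hp : 0 < |r| ^ γ := Real.rpow_pos_of_pos hr' _
    rcases lt_or_gt_of_ne hr with hneg | hpos
    · have := hhom |r| hr' (-1) (-1)
      rw [show |r| * -1 = r by rw [abs_of_neg hneg]; ring] at this
      rw [this, abs_mul, abs_of_pos hp]
      gcongr
      linarith [abs_nonneg (C 1 1)]
    · have := hhom |r| hr' 1 1
      rw [show |r| * 1 = r by rw [abs_of_pos hpos]; ring] at this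
      rw [this, abs_mul, abs_of_pos hp]
      gcongr
      linarith [abs_nonneg (C (-1) (-1))]
  refine ⟨2 ^ (γ / 2) + |a| * (|C 1 1| + |C (-1) (-1)|), by positivity, ?_⟩
  have hsmall : ∀ᶠ r in 𝓝 (0 : ℝ), r ^ 2 + r ^ 2 < δ ^ 2 :=
    (Continuous.tendsto' (by fun_prop) (0 : ℝ) (0 : ℝ) (by simp)).eventually_lt_const
      (by positivity)
  filter_upwards [hsmall] with r hr
  rcases eq_or_ne r 0 with rfl | hr0
  · simp [hv0, Real.zero_rpow hγ.ne']
  · have h1 := h r hr0 hr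
    rw [hpow] at h1
    have h2 : |a * C r r| ≤ |a| * (|r| ^ γ * (|C 1 1| + |C (-1) (-1)|)) := by
      rw [abs_mul]
      gcongr
      exact hC r hr0
    have h3 := (abs_le.1 h1).2
    have h4 := le_abs_self (a * C r r)
    linarith

theorem mul_isLittleO_rpow_add_sq {γ : ℝ} (hγ : γ < 2) :
    (fun p : ℝ × ℝ => p.1 * p.2) =o[𝓝[≠] (0 : ℝ × ℝ)]
      fun p : ℝ × ℝ => (p.1 ^ 2 + p.2 ^ 2) ^ (γ / 2) := by
  have h1 : (fun p : ℝ × ℝ => p.1 * p.2) =O[𝓝[≠] (0 : ℝ × ℝ)]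
      fun p : ℝ × ℝ => p.1 ^ 2 + p.2 ^ 2 := by
    refine IsBigO.of_bound 1 (Eventually.of_forall fun p => ?_)
    rw [Real.norm_eq_abs, Real.norm_eq_abs, one_mul, abs_of_nonneg (a := p.1 ^ 2 + p.2 ^ 2)
      (by positivity), abs_le]
    constructor <;> nlinarith [sq_nonneg (p.1 + p.2), sq_nonneg (p.1 - p.2)]
  refine h1.trans_isLittleO ?_
  have ht : Tendsto (fun p : ℝ × ℝ => (p.1 ^ 2 + p.2 ^ 2) ^ (1 - γ / 2)) (𝓝[≠] 0) (𝓝 0) := by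
    refine (Continuous.tendsto' ?_ (0 : ℝ × ℝ) (0 : ℝ) ?_).mono_left nhdsWithin_le_nhds
    · exact (by fun_prop : Continuous fun p : ℝ × ℝ => p.1 ^ 2 + p.2 ^ 2).rpow_const
        fun p => Or.inr (by linarith)
    · simp only [Prod.fst_zero, Prod.snd_zero]
      rw [show (0 : ℝ) ^ 2 + 0 ^ 2 = 0 by ring, Real.zero_rpow (by linarith)]
  have h2 := ((isLittleO_one_iff ℝ).2 ht).mul_isBigO
    (isBigO_refl (fun p : ℝ × ℝ => (p.1 ^ 2 + p.2 ^ 2) ^ (γ / 2)) (𝓝[≠] 0))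
  simp only [one_mul] at h2
  refine h2.congr_left fun p => ?_
  rw [← Real.rpow_add' (by positivity) (by norm_num)]
  norm_num

/-- Smooth functions of Gaussian processes satisfying the uniform increment-covariance
expansion again satisfy the expansion, with `L^{(V)}(τ) = E[(f′(Z_τ))²]·L(τ)` and the same
`C_γ` (Proposition 2.7 of the paper).  Gaussianity of the process is expressed by every finite
linear combination of its values being a Gaussian real random variable. -/
theorem stmt17 {Ω : Type*} [MeasurableSpace Ω] (P : Measure Ω) [IsProbabilityMeasure P]
    (T γ : ℝ) (hT : 0 < T) (hγ1 : 1 ≤ γ) (hγ2 : γ < 2)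
    (Z : ℝ → Ω → ℝ) (hZmeas : ∀ t, Measurable (Z t))
    (hZcont : ∀ ω, ContinuousOn (fun t => Z t ω) (Icc 0 T))
    (hGauss : ∀ (n : ℕ) (t : Fin n → ℝ) (c : Fin n → ℝ),
      ∃ (μ : ℝ) (σ2 : ℝ≥0),
        Measure.map (fun ω => ∑ i, c i * Z (t i) ω) P = gaussianReal μ σ2)
    (L : ℝ → ℝ) (hLb : ∃ M : ℝ, ∀ t ∈ Ioo (0 : ℝ) T, |L t| ≤ M)
    (C : ℝ → ℝ → ℝ)
    (hhom : ∀ h : ℝ, 0 < h → ∀ r s : ℝ, C (h * r) (h * s) = h ^ γ * C r s)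
    (hunif : ∀ ε : ℝ, 0 < ε → ∃ δ : ℝ, 0 < δ ∧ ∀ r s : ℝ, ¬(r = 0 ∧ s = 0) →
      r ^ 2 + s ^ 2 < δ ^ 2 → ∀ t ∈ Ioo (0 : ℝ) T,
        |(∫ ω, (Z (t + r) ω - Z t ω) * (Z (t + s) ω - Z t ω) ∂P) - L t * C r s|
          ≤ ε * (r ^ 2 + s ^ 2) ^ (γ / 2))
    (τ : ℝ) (hτ : τ ∈ Ioo (0 : ℝ) T) (f : ℝ → ℝ) (hf : ContDiff ℝ 2 f)
    (ha1 : (fun r => ∫ ω, (Z (τ + r) ω - Z τ ω) * Z τ ω ∂P) =O[𝓝 (0 : ℝ)] fun r => r)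
    (ha2 : (fun r => (∫ ω, Z (τ + r) ω ∂P) - ∫ ω, Z τ ω ∂P) =O[𝓝 (0 : ℝ)] fun r => r)
    (hb1 : Integrable (fun ω => (deriv f (Z τ ω)) ^ 4) P)
    (hb2 : ∃ ε : ℝ, 0 < ε ∧ ∃ M : Ω → ℝ, Integrable M P ∧
      ∀ ω, ∀ t ∈ Ioo (τ - ε) (τ + ε), (deriv (deriv f) (Z t ω)) ^ 4 ≤ M ω) :
    (fun p : ℝ × ℝ =>
        (∫ ω, (f (Z (τ + p.1) ω) - f (Z τ ω)) * (f (Z (τ + p.2) ω) - f (Z τ ω)) ∂P)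
          - (∫ ω, (deriv f (Z τ ω)) ^ 2 ∂P) * (L τ * C p.1 p.2))
      =o[𝓝[≠] (0 : ℝ × ℝ)] fun p : ℝ × ℝ => (p.1 ^ 2 + p.2 ^ 2) ^ (γ / 2) := by
  have hderiv : ContDiff ℝ 1 (deriv f) := ((contDiff_succ_iff_deriv (n := 1)).1 hf).2.2
  have hfm : Measurable f := hf.continuous.measurable
  have hf'm : Measurable (deriv f) := hderiv.continuous.measurable
  have hγ0 : 0 < γ := by linarith
  set U : ℝ → Ω → ℝ := fun r ω => Z (τ + r) ω - Z τ ω with hUdef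
  have hUm : ∀ r, Measurable (U r) := fun r => (hZmeas _).sub (hZmeas _)
  have hG : ∀ r s a b c : ℝ, HasGaussianLaw (fun ω => a * Z τ ω + b * U r ω + c * U s ω) P := by
    intro r s a b c
    obtain ⟨μ, σ2, hμ⟩ := hGauss 3 ![τ, τ + r, τ + s] ![a - b - c, b, c]
    have he : (fun ω => a * Z τ ω + b * U r ω + c * U s ω) =
        fun ω => ∑ i, (![a - b - c, b, c] : Fin 3 → ℝ) i *
          Z ((![τ, τ + r, τ + s] : Fin 3 → ℝ) i) ω := by
      funext ω
      simp [Fin.sum_univ_three, hUdef]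
      ring
    rw [he]
    refine ⟨?_⟩
    rw [hμ]
    infer_instance
  have hGU : ∀ r, HasGaussianLaw (U r) P := fun r => by simpa using hG r 0 0 1 0
  have hU8 : ∀ r, Integrable (fun ω => U r ω ^ 8) P := fun r => by
    have := ((hGU r).memLp (p := (8 : ℕ)) (by simp)).integrable_norm_pow (by norm_num)
    refine this.congr (ae_of_all _ fun ω => ?_)
    show ‖U r ω‖ ^ 8 = U r ω ^ 8
    rw [Real.norm_eq_abs, Even.pow_abs (by decide)]
  set q : ℝ × ℝ → ℝ := fun p => (p.1 ^ 2 + p.2 ^ 2) ^ (γ / 2) with hq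
  -- second moments of the increments
  obtain ⟨B, hB0, hB⟩ : ∃ B : ℝ, 0 ≤ B ∧ ∀ᶠ r in 𝓝 (0 : ℝ),
      ∫ ω, U r ω ^ 2 ∂P ≤ B * |r| ^ γ := by
    refine exists_eventually_le_mul_abs_rpow (v := fun r => ∫ ω, U r ω ^ 2 ∂P) (a := L τ) hγ0
      (by simp [hUdef]) hhom ?_
    obtain ⟨δ, hδ, h⟩ := hunif 1 one_pos
    refine ⟨δ, hδ, fun r hr0 hr => ?_⟩
    have := h r r (fun h0 => hr0 h0.1) hr τ hτ
    simpa only [hUdef, sq (_ - _), one_mul] using this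
  obtain ⟨K, hK0, hK⟩ := exists_integral_pow_eight_le
  have hq_ge : ∀ p : ℝ × ℝ, |p.1| ^ γ ≤ q p ∧ |p.2| ^ γ ≤ q p := fun p => by
    have key : ∀ x y : ℝ, |x| ^ γ ≤ (x ^ 2 + y ^ 2) ^ (γ / 2) := fun x y => by
      have : |x| ^ γ = (x ^ 2) ^ (γ / 2) := by
        rw [← sq_abs, ← Real.rpow_natCast, ← Real.rpow_mul (abs_nonneg _)]
        congr 1
        push_cast
        ring
      rw [this]
      gcongr
      linarith [sq_nonneg y]
    exact ⟨key _ _, by simpa only [hq, add_comm] using key p.2 p.1⟩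
  have hq0 : ∀ p, 0 ≤ q p := fun p => by positivity
  have hq_tendsto : Tendsto q (𝓝 0) (𝓝 0) := by
    refine Continuous.tendsto' ?_ (0 : ℝ × ℝ) (0 : ℝ) ?_
    · exact (by fun_prop : Continuous fun p : ℝ × ℝ => p.1 ^ 2 + p.2 ^ 2).rpow_const
        fun p => Or.inr (by positivity)
    · simp [hq, Real.zero_rpow (show γ / 2 ≠ 0 by positivity)]
  have hfst : Tendsto (Prod.fst : ℝ × ℝ → ℝ) (𝓝[≠] 0) (𝓝 0) :=
    (continuous_fst.tendsto' _ _ rfl).mono_left nhdsWithin_le_nhds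
  have hsnd : Tendsto (Prod.snd : ℝ × ℝ → ℝ) (𝓝[≠] 0) (𝓝 0) :=
    (continuous_snd.tendsto' _ _ rfl).mono_left nhdsWithin_le_nhds
  have hU8B : ∀ {r x : ℝ}, 0 ≤ x → |r| ^ γ ≤ x → ∫ ω, U r ω ^ 2 ∂P ≤ B * |r| ^ γ →
      ∫ ω, U r ω ^ 8 ∂P ≤ K * B ^ 4 * √x ^ 8 := fun {r x} hx0 hx h => by
    refine (hK P (U r) (hGU r)).trans ?_
    rw [show √x ^ 8 = (√x ^ 2) ^ 4 by ring, Real.sq_sqrt hx0, mul_assoc, ← mul_pow]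
    exact mul_le_mul_of_nonneg_left (pow_le_pow_left₀ (integral_nonneg fun ω => sq_nonneg _)
      (h.trans (mul_le_mul_of_nonneg_left hx hB0)) 4) hK0
  -- Taylor expansion along the paths
  obtain ⟨ε, hε, M, hMint, hM⟩ := hb2
  have hM0 : ∀ ω, 0 ≤ M ω := fun ω =>
    (by positivity : (0 : ℝ) ≤ deriv (deriv f) (Z τ ω) ^ 4).trans
      (hM ω τ ⟨by linarith, by linarith⟩)
  have hM4 : ∀ ω, √√(M ω) ^ 4 = M ω := fun ω => by
    rw [show √√(M ω) ^ 4 = (√√(M ω) ^ 2) ^ 2 by ring, Real.sq_sqrt (Real.sqrt_nonneg _),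
      Real.sq_sqrt (hM0 ω)]
  have htaylor : ∀ᶠ r in 𝓝 (0 : ℝ), ∀ ω,
      |f (Z (τ + r) ω) - f (Z τ ω) - deriv f (Z τ ω) * U r ω| ≤ √√(M ω) * U r ω ^ 2 := by
    have hI : ∀ᶠ r in 𝓝 (0 : ℝ), τ + r ∈ Ioo (τ - ε) (τ + ε) ∩ Ioo 0 T :=
      (Continuous.tendsto' (by fun_prop) (0 : ℝ) τ (by simp)).eventually
        (((isOpen_Ioo.inter isOpen_Ioo).mem_nhds ⟨⟨by linarith, by linarith⟩, hτ⟩))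
    filter_upwards [hI] with r hr ω
    have hsub1 : uIcc τ (τ + r) ⊆ Ioo (τ - ε) (τ + ε) :=
      ordConnected_Ioo.uIcc_subset ⟨by linarith, by linarith⟩ hr.1
    have hsub2 : uIcc τ (τ + r) ⊆ Icc 0 T :=
      (ordConnected_Ioo.uIcc_subset hτ hr.2).trans Ioo_subset_Icc_self
    refine abs_path_taylor_remainder_le (z := fun t => Z t ω) hf ((hZcont ω).mono hsub2)
      fun t ht => ?_
    refine Real.le_sqrt_of_sq_le (Real.le_sqrt_of_sq_le ?_)
    rw [sq_abs, ← pow_mul]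
    exact hM ω t (hsub1 ht)
  have hE1 : (fun p : ℝ × ℝ =>
      (∫ ω, (f (Z (τ + p.1) ω) - f (Z τ ω)) * (f (Z (τ + p.2) ω) - f (Z τ ω)) ∂P) -
        ∫ ω, deriv f (Z τ ω) ^ 2 * (U p.1 ω * U p.2 ω) ∂P) =o[𝓝[≠] (0 : ℝ × ℝ)] q := by
    have hO : (fun p : ℝ × ℝ =>
      (∫ ω, (f (Z (τ + p.1) ω) - f (Z τ ω)) * (f (Z (τ + p.2) ω) - f (Z τ ω)) ∂P) -
        ∫ ω, deriv f (Z τ ω) ^ 2 * (U p.1 ω * U p.2 ω) ∂P) =O[𝓝[≠] (0 : ℝ × ℝ)]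
          fun p => √(q p) * q p := by
      refine IsBigO.of_bound (4 * (1 + ∫ ω, deriv f (Z τ ω) ^ 4 ∂P + ∫ ω, √√(M ω) ^ 4 ∂P +
        K * B ^ 4 + K * B ^ 4)) ?_
      filter_upwards [hfst.eventually htaylor, hsnd.eventually htaylor, hfst.eventually hB,
        hsnd.eventually hB, (hq_tendsto.mono_left nhdsWithin_le_nhds).eventually_lt_const one_pos,
        self_mem_nhdsWithin] with p t1 t2 b1 b2 hq1 hp
      have hsum : 0 < p.1 ^ 2 + p.2 ^ 2 := by
        by_contra hcon
        have h1 : p.1 = 0 := by nlinarith [sq_nonneg p.1, sq_nonneg p.2]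
        have h2 : p.2 = 0 := by nlinarith [sq_nonneg p.1, sq_nonneg p.2]
        exact hp (Prod.ext h1 h2)
      have hqpos : 0 < q p := Real.rpow_pos_of_pos hsum _
      have := abs_integral_mul_sub_linear_mul_linear_le (P := P)
        (A := fun ω => f (Z (τ + p.1) ω) - f (Z τ ω))
        (A' := fun ω => f (Z (τ + p.2) ω) - f (Z τ ω)) (g := fun ω => deriv f (Z τ ω))
        (U := U p.1) (V := U p.2) (k := fun ω => √√(M ω)) (κ := √(q p)) (B := K * B ^ 4)
        (Real.sqrt_pos.2 hqpos) (Real.sqrt_le_one.2 hq1.le)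
        ((hfm.comp (hZmeas _)).sub (hfm.comp (hZmeas _)))
        ((hfm.comp (hZmeas _)).sub (hfm.comp (hZmeas _)))
        (hf'm.comp (hZmeas _)) (hUm _) (hUm _) (fun ω => Real.sqrt_nonneg _) t1 t2 hb1
        (hMint.congr (ae_of_all _ fun ω => (hM4 ω).symm)) (hU8 _) (hU8 _)
        (hU8B (hq0 p) (hq_ge p).1 b1) (hU8B (hq0 p) (hq_ge p).2 b2)
      rw [Real.norm_eq_abs, Real.norm_eq_abs, abs_of_nonneg (a := √(q p) * q p) (by positivity)]
      refine this.trans_eq ?_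
      rw [show √(q p) ^ 3 = √(q p) * √(q p) ^ 2 by ring, Real.sq_sqrt (hq0 p)]
      ring
    refine hO.trans_isLittleO ?_
    have hs : Tendsto (fun p => √(q p)) (𝓝[≠] (0 : ℝ × ℝ)) (𝓝 0) := by
      simpa using (hq_tendsto.mono_left nhdsWithin_le_nhds).sqrt
    simpa using ((isLittleO_one_iff ℝ).2 hs).mul_isBigO (isBigO_refl q (𝓝[≠] 0))
  have hE2 : (fun p : ℝ × ℝ => ∫ ω, deriv f (Z τ ω) ^ 2 * (U p.1 ω * U p.2 ω) ∂P -
      (∫ ω, deriv f (Z τ ω) ^ 2 ∂P) * ∫ ω, U p.1 ω * U p.2 ω ∂P) =o[𝓝[≠] (0 : ℝ × ℝ)] q := by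
    have hU1 : (fun r => ∫ ω, U r ω ∂P) =O[𝓝 (0 : ℝ)] fun r => r := by
      refine ha2.congr_left fun r => ?_
      have hZi : ∀ t, Integrable (Z t) P := fun t => by
        have := (hG (t - τ) 0 1 1 0).integrable
        simpa [hUdef] using this
      exact (integral_sub (hZi _) (hZi _)).symm
    have hg2 : MemLp (fun ω => deriv f (Z τ ω) ^ 2) 2 P := by
      refine (memLp_two_iff_integrable_sq (f := fun ω => deriv f (Z τ ω) ^ 2)
        ((hf'm.comp (hZmeas τ)).pow_const 2).aestronglyMeasurable).2 ?_
      refine hb1.congr (ae_of_all _ fun ω => ?_)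
      show deriv f (Z τ ω) ^ 4 = (deriv f (Z τ ω) ^ 2) ^ 2
      ring
    exact ((isBigO_integral_comp_mul_increments (hZmeas τ) hUm hG ha1 hU1
      (g := fun x => deriv f x ^ 2) (hf'm.pow_const 2) hg2).mono nhdsWithin_le_nhds).trans_isLittleO
      (mul_isLittleO_rpow_add_sq hγ2)
  have hE3 : (fun p : ℝ × ℝ => (∫ ω, U p.1 ω * U p.2 ω ∂P) - L τ * C p.1 p.2)
      =o[𝓝[≠] (0 : ℝ × ℝ)] q := by
    refine isLittleO_iff.2 fun c hc => ?_
    obtain ⟨δ, hδ, h⟩ := hunif c hc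
    have hsmall : ∀ᶠ p : ℝ × ℝ in 𝓝[≠] 0, p.1 ^ 2 + p.2 ^ 2 < δ ^ 2 :=
      ((Continuous.tendsto' (by fun_prop) (0 : ℝ × ℝ) (0 : ℝ) (by simp)).mono_left
        nhdsWithin_le_nhds).eventually_lt_const (by positivity)
    filter_upwards [hsmall, self_mem_nhdsWithin] with p hp hp0
    rw [Real.norm_eq_abs, Real.norm_eq_abs, abs_of_nonneg (hq0 p)]
    exact h p.1 p.2 (fun h0 => hp0 (Prod.ext h0.1 h0.2)) hp τ hτ
  refine ((hE1.add hE2).add (hE3.const_mul_left (∫ ω, deriv f (Z τ ω) ^ 2 ∂P))).congr_left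
    fun p => ?_
  ring
end
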